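/- arXiv:1004.1938 — 3 statements merged into one kernel-verified Lean document; each statement's English description precedes it below -/
import Mathlib

section
/- Let d, r be integers with 0 < r ≤ d, set n = d + r, and let A ∈ M_n^d. Then there exist a permutation σ of the rows of A and a permutation τ of the columns of A such that the resulting matrix B = (b_{i,j}), b_{i,j} = a_{σ(i),τ(j)}, lies in Γ_n^d with configuration (y_1,…,y_n) satisfying y_i = 1 for all 1 ≤ i ≤ ⌊n/2⌋ and y_i = r+1 for all ⌈n/2⌉ < i ≤ n (when n is odd, the value y_{⌈n/2⌉} of the middle row is unconstrained). -/
/-- The permanent of an `n × n` matrix: `per(A) = ∑_{σ ∈ S_n} ∏_i A i (σ i)`. -/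
def permanent {n : ℕ}  (A : Matrix (Fin n) (Fin n) ℕ) : ℕ :=
  ∑ σ : Equiv.Perm (Fin n), ∏ i, A i (σ i)

/-- The `(0,1)`-matrix determined by the configuration `x` (1-indexed starting columns):
entry `(i,j)` (with `j : Fin n` representing column `j+1`) is `1` iff
`x i ≤ j+1 ≤ x i + d - 1`. -/
def confMatrix (n d : ℕ) (x : Fin n → ℕ) : Matrix (Fin n) (Fin n) ℕ :=
  fun i j => if x i ≤ (j : ℕ) + 1 ∧ (j : ℕ) + 1 ≤ x i + d - 1 then 1 else 0

/-- A valid configuration for `Γ_n^d`: `1 ≤ x i ≤ n - d + 1` for all `i`. -/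
def ValidConf (n d : ℕ) (x : Fin n → ℕ) : Prop :=
  ∀ i, 1 ≤ x i ∧ x i ≤ n - d + 1

/-- Membership in `Γ_n^d`: the set of `n × n` `(0,1)`-matrices each of whose rows has
exactly `d` ones forming a contiguous block. -/
def IsGamma (n d : ℕ) (A : Matrix (Fin n) (Fin n) ℕ) : Prop :=
  ∃ x : Fin n → ℕ, ValidConf n d x ∧ A = confMatrix n d x

/-- The injective `k`-tuples of rows whose `i`-th entry satisfies `a i`. -/
def injTuples {n : ℕ} (a : ℕ → Fin n → Prop) [∀ i, DecidablePred (a i)] (k : ℕ) :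
    Finset (Fin k → Fin n) :=
  Finset.univ.filter fun f => Function.Injective f ∧ ∀ i : Fin k, a i (f i)

/-- The rows satisfying `p` that are not used by the tuple `f`. -/
def freeRows {n k : ℕ} (p : Fin n → Prop) [DecidablePred p] (f : Fin k → Fin n) :
    Finset (Fin n) :=
  Finset.univ.filter fun x => p x ∧ ∀ i, f i ≠ x

section Counting

variable {n : ℕ} (a : ℕ → Fin n → Prop) [∀ i, DecidablePred (a i)]

theorem sum_injTuples_succ (k : ℕ) (h : (Fin k → Fin n) → ℕ) :
    ∑ f ∈ injTuples a (k + 1), h (Fin.init f) =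
      ∑ f ∈ injTuples a k, h f * (freeRows (a k) f).card := by
  have key : ∑ f ∈ injTuples a (k + 1), h (Fin.init f) =
      ∑ p ∈ (injTuples a k).sigma fun f => freeRows (a k) f, h p.1 := by
    refine Finset.sum_bij' (fun f _ => ⟨Fin.init f, f (Fin.last k)⟩)
      (fun p _ => Fin.snoc (α := fun _ => Fin n) p.1 p.2) ?_ ?_ ?_ ?_ ?_
    · intro f hf
      simp only [injTuples, freeRows, Finset.mem_filter, Finset.mem_univ, true_and,
        Finset.mem_sigma] at hf ⊢
      obtain ⟨hi, ha⟩ := hf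
      refine ⟨⟨fun i j hij => ?_, fun i => ?_⟩, ?_, fun i hij => ?_⟩
      · exact Fin.castSucc_injective k (hi hij)
      · exact ha i.castSucc
      · simpa using ha (Fin.last k)
      · exact absurd (hi hij) (Fin.castSucc_lt_last i).ne
    · rintro ⟨f, x⟩ hp
      simp only [injTuples, freeRows, Finset.mem_filter, Finset.mem_univ, true_and,
        Finset.mem_sigma] at hp ⊢
      obtain ⟨⟨hi, ha⟩, hx, hfx⟩ := hp
      refine ⟨?_, fun i => ?_⟩
      · rw [Fin.snoc_injective_iff]
        exact ⟨hi, by simpa using hfx⟩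
      · refine Fin.lastCases ?_ (fun i => ?_) i
        · simpa using hx
        · simpa using ha i
    · intro f _
      simp
    · rintro ⟨f, x⟩ _
      simp
    · intro f _
      rfl
  rw [key, Finset.sum_sigma]
  simp [mul_comm]

theorem card_injTuples_succ (k : ℕ) :
    (injTuples a (k + 1)).card = ∑ f ∈ injTuples a k, (freeRows (a k) f).card := by
  simpa using sum_injTuples_succ a k (fun _ => 1)

theorem card_injTuples_add_two (k : ℕ) (hk : ∀ x, a (k + 1) x ↔ ¬ a k x) :
    (injTuples a (k + 2)).card =
      ∑ f ∈ injTuples a k, (freeRows (fun x => ¬ a k x) f).card * (freeRows (a k) f).card := by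
  rw [card_injTuples_succ, ← sum_injTuples_succ]
  refine Finset.sum_congr rfl fun f hf => ?_
  simp only [injTuples, Finset.mem_filter, Finset.mem_univ, true_and] at hf
  refine congrArg Finset.card (Finset.filter_congr fun x _ => ?_)
  simp only [hk, Fin.forall_fin_succ', Fin.init, ← and_assoc]
  refine and_iff_left_of_imp fun hx => ?_
  rintro rfl
  exact hx.1 (by simpa using hf.2 (Fin.last k))

theorem card_freeRows_true {k : ℕ} {f : Fin k → Fin n} (hf : Function.Injective f) :
    (freeRows (fun _ => True) f).card = n - k := by
  have : freeRows (fun _ => True) f = (Finset.univ.image f)ᶜ := by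
    ext x; simp [freeRows]
  rw [this, Finset.card_compl, Finset.card_image_of_injective _ hf]
  simp

theorem card_freeRows_add_card_freeRows_not {k : ℕ} {f : Fin k → Fin n}
    (hf : Function.Injective f) (p : Fin n → Prop) [DecidablePred p] :
    (freeRows (fun x => ¬ p x) f).card + (freeRows p f).card = n - k := by
  rw [← card_freeRows_true hf, add_comm,
    ← Finset.card_filter_add_card_filter_not (s := freeRows (fun _ => True) f) p]
  refine congrArg₂ _ (congrArg _ ?_) (congrArg _ ?_) <;> (ext x; simp [freeRows, and_comm])

theorem card_injTuples_add {k m : ℕ} (h : ∀ i, k ≤ i → i < k + m → ∀ x, a i x) (hkm : k + m = n) :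
    (injTuples a (k + m)).card = (injTuples a k).card * m.factorial := by
  have main : ∀ j ≤ m, (injTuples a (k + j)).card * (m - j).factorial =
      (injTuples a k).card * m.factorial := by
    intro j
    induction j with
    | zero => simp
    | succ j ih =>
      intro hj
      rw [← ih (by omega), ← add_assoc, card_injTuples_succ,
        Finset.sum_const_nat (m := m - j), mul_assoc]
      · congr 1
        obtain ⟨i, hi⟩ : ∃ i, m - j = i + 1 := ⟨m - j - 1, by omega⟩
        rw [hi, Nat.factorial_succ, show m - (j + 1) = i by omega]
      · intro f hf
        have hf' : Function.Injective f := by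
          simp only [injTuples, Finset.mem_filter] at hf
          exact hf.2.1
        have : freeRows (a (k + j)) f = freeRows (fun _ => True) f := by
          ext x
          simp [freeRows, h (k + j) (by omega) (by omega)]
        rw [this, card_freeRows_true hf']
        omega
  simpa using main m le_rfl

end Counting

/-- The largest product of two natural numbers with sum `m`. -/
def maxProd (m : ℕ) : ℕ := m / 2 * (m - m / 2)

theorem mul_le_maxProd {x y m : ℕ} (h : x + y = m) : x * y ≤ maxProd m := by
  unfold maxProd
  obtain ⟨k, hk⟩ := Nat.even_or_odd' m
  rcases hk with hk | hk
  · rw [show m / 2 = k by omega, show m - k = k by omega]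
    nlinarith [sq_nonneg ((x : ℤ) - y), h, hk]
  · rw [show m / 2 = k by omega, show m - k = k + 1 by omega]
    zify at *
    rcases le_or_gt x k with hx | hx
    · obtain ⟨z, rfl⟩ := Nat.exists_eq_add_of_le hx
      push_cast at *
      have hy : (y : ℤ) = x + 2 * z + 1 := by linarith
      rw [hy]
      nlinarith
    · obtain ⟨z, rfl⟩ := Nat.exists_eq_add_of_lt hx
      push_cast at *
      have hy : (y : ℤ) = k - z := by linarith
      rw [hy]
      nlinarith

theorem half_le_of_maxProd_le {x y m : ℕ} (h : x + y = m) (hxy : maxProd m ≤ x * y) :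
    m / 2 ≤ x := by
  unfold maxProd at hxy
  by_contra! hx
  obtain ⟨z, hz⟩ := Nat.exists_eq_add_of_lt hx
  obtain ⟨w, hw⟩ : ∃ w, m - m / 2 = m / 2 + w := ⟨m - m / 2 - m / 2, by omega⟩
  have hy : y = m / 2 + w + z + 1 := by omega
  rw [hw, hy, hz] at hxy
  nlinarith [Nat.zero_le (w * z), Nat.zero_le (z * z)]

theorem maxProd_pos {m : ℕ} (h : 2 ≤ m) : 0 < maxProd m :=
  Nat.mul_pos (by omega) (by omega)

section Pairs

variable {n : ℕ} (a : ℕ → Fin n → Prop) [∀ i, DecidablePred (a i)]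

theorem card_injTuples_le (t : ℕ) (h : ∀ j, j ≤ t → ∀ x, a (2 * j + 1) x ↔ ¬ a (2 * j) x) :
    (injTuples a (2 * (t + 1))).card ≤
      (Finset.univ.filter (a 0)).card * (n - (Finset.univ.filter (a 0)).card) *
        ∏ j ∈ Finset.range t, maxProd (n - 2 * (j + 1)) := by
  induction t with
  | zero =>
    have h0 := card_injTuples_add_two a 0 (h 0 le_rfl)
    have hs := card_freeRows_add_card_freeRows_not
      (Function.injective_of_subsingleton (default : Fin 0 → Fin n)) (a 0)
    have hf : ∀ f : Fin 0 → Fin n, freeRows (a 0) f = Finset.univ.filter (a 0) := by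
      intro f; ext x; simp [freeRows]
    have hX : injTuples a 0 = {default} := by
      ext f
      simp [injTuples, Function.injective_of_subsingleton, Subsingleton.elim f default]
    rw [hX, Finset.sum_singleton] at h0
    rw [hf] at h0 hs
    rw [Finset.prod_range_zero, mul_one, show 2 * (0 + 1) = 0 + 2 by rfl, h0, mul_comm]
    apply le_of_eq
    congr 1
    omega
  | succ t ih =>
    rw [Finset.prod_range_succ, ← mul_assoc, show 2 * (t + 1 + 1) = 2 * (t + 1) + 2 by ring,
      card_injTuples_add_two a _ (h (t + 1) le_rfl)]
    refine (Finset.sum_le_card_nsmul _ _ (maxProd (n - 2 * (t + 1))) fun f hf => ?_).trans ?_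
    · simp only [injTuples, Finset.mem_filter] at hf
      exact mul_le_maxProd (card_freeRows_add_card_freeRows_not hf.2.1 _)
    · rw [smul_eq_mul]
      exact Nat.mul_le_mul_right _ (ih fun j hj => h j (by omega))

theorem le_card_freeRows {k t : ℕ} {f : Fin k → Fin n} (p : Fin n → Prop) [DecidablePred p]
    (g : Fin t → Fin k) (h : ∀ i, p (f i) → ∃ j, g j = i) :
    (Finset.univ.filter p).card - t ≤ (freeRows p f).card := by
  have hsub : Finset.univ.filter p \ Finset.univ.image (f ∘ g) ⊆ freeRows p f := by
    intro x hx
    simp only [Finset.mem_sdiff, Finset.mem_filter, Finset.mem_univ, true_and,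
      Finset.mem_image, not_exists, freeRows] at hx ⊢
    refine ⟨hx.1, ?_⟩
    rintro i rfl
    obtain ⟨j, rfl⟩ := h i hx.1
    exact hx.2 j rfl
  have h1 := Finset.card_le_card hsub
  have h2 := Finset.le_card_sdiff (Finset.univ.image (f ∘ g)) (Finset.univ.filter p)
  have h3 : (Finset.univ.image (f ∘ g)).card ≤ t := by
    simpa using Finset.card_image_le (s := Finset.univ) (f := f ∘ g)
  omega

theorem le_card_injTuples (p : Fin n → Prop) [DecidablePred p]
    (hp : (Finset.univ.filter p).card = n / 2) (t : ℕ)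
    (h : ∀ j < t, ∀ x, (a (2 * j) x ↔ p x) ∧ (a (2 * j + 1) x ↔ ¬ p x)) :
    ∏ j ∈ Finset.range t, maxProd (n - 2 * j) ≤ (injTuples a (2 * t)).card := by
  have hnp : (Finset.univ.filter fun x => ¬ p x).card = n - n / 2 := by
    have := Finset.card_filter_add_card_filter_not (s := (Finset.univ : Finset (Fin n))) p
    simp only [Finset.card_univ, Fintype.card_fin] at this
    omega
  induction t with
  | zero => simp [injTuples, Function.injective_of_subsingleton]
  | succ t ih =>
    rw [Finset.prod_range_succ, show 2 * (t + 1) = 2 * t + 2 by ring, card_injTuples_add_two a _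
      fun x => by rw [(h t (by omega) x).1, (h t (by omega) x).2]]
    refine (Nat.mul_le_mul_right _ (ih fun j hj => h j (by omega))).trans ?_
    rw [← smul_eq_mul]
    refine Finset.card_nsmul_le_sum _ _ _ fun f hf => ?_
    simp only [injTuples, Finset.mem_filter, Finset.mem_univ, true_and] at hf
    have hpa : ∀ x, a (2 * t) x ↔ p x := fun x => (h t (by omega) x).1
    have h1 : n / 2 - t ≤ (freeRows (a (2 * t)) f).card := by
      rw [← hp]
      simp only [← hpa]
      refine le_card_freeRows _ (fun j : Fin t => (⟨2 * j, by omega⟩ : Fin (2 * t))) fun i hi => ?_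
      rcases Nat.even_or_odd' (i : ℕ) with ⟨j, hj | hj⟩
      · exact ⟨⟨j, by omega⟩, Fin.ext hj.symm⟩
      · have := hf.2 i
        rw [hj, (h j (by omega) _).2] at this
        exact absurd ((hpa _).1 hi) this
    have h2 : n - n / 2 - t ≤ (freeRows (fun x => ¬ a (2 * t) x) f).card := by
      rw [← hnp]
      simp only [← hpa]
      refine le_card_freeRows _ (fun j : Fin t => (⟨2 * j + 1, by omega⟩ : Fin (2 * t)))
        fun i hi => ?_
      rcases Nat.even_or_odd' (i : ℕ) with ⟨j, hj | hj⟩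
      · have := hf.2 i
        rw [hj, (h j (by omega) _).1] at this
        exact absurd ((hpa _).2 this) hi
      · exact ⟨⟨j, by omega⟩, Fin.ext hj.symm⟩
    refine le_trans (le_of_eq ?_) ((Nat.mul_le_mul h1 h2).trans_eq (mul_comm _ _))
    unfold maxProd
    congr 1 <;> omega

end Pairs

theorem permanent_eq_card {n : ℕ} (A : Matrix (Fin n) (Fin n) ℕ)
    (hA : ∀ i j, A i j = 0 ∨ A i j = 1) (e : Equiv.Perm (Fin n))
    (a : ℕ → Fin n → Prop) [∀ i, DecidablePred (a i)]
    (ha : ∀ k : Fin n, ∀ x, a k x ↔ A x (e k) = 1) :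
    permanent A = (injTuples a n).card := by
  have h1 : permanent A = ∑ σ : Equiv.Perm (Fin n), ∏ k, A (σ k) (e k) := by
    refine Fintype.sum_equiv ((Equiv.inv _).trans (Equiv.mulRight e)) _ _ fun σ => ?_
    refine (Fintype.prod_equiv (e.trans σ.symm) _ _ fun k => ?_).symm
    simp [Equiv.Perm.mul_apply, ← Equiv.Perm.inv_def]
  have h2 : ∀ σ : Equiv.Perm (Fin n),
      ∏ k, A (σ k) (e k) = if ∀ k : Fin n, a k (σ k) then 1 else 0 := by
    intro σ
    split_ifs with h
    · exact Finset.prod_eq_one fun k _ => (ha _ _).1 (h k)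
    · push Not at h
      obtain ⟨k, hk⟩ := h
      exact Finset.prod_eq_zero (Finset.mem_univ k)
        ((hA _ _).resolve_right fun h' => hk ((ha _ _).2 h'))
  rw [h1, Finset.sum_congr rfl fun σ _ => h2 σ, Finset.sum_boole, Nat.cast_id]
  refine Finset.card_bij (fun σ _ => ⇑σ) ?_ (fun _ _ _ _ h => DFunLike.coe_injective h) ?_
  · intro σ hσ
    simpa [injTuples, σ.injective] using hσ
  · intro f hf
    simp only [injTuples, Finset.mem_filter, Finset.mem_univ, true_and] at hf
    exact ⟨Equiv.ofBijective f (Finite.injective_iff_bijective.1 hf.1), by simpa using hf.2, rfl⟩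

/-- An ordering of the columns: the complementary pairs `(π j, d + π j)` for `j < r` come first,
followed by the columns that are full in every matrix of `Γ_{d+r}^d`. -/
def pairOrder (d r : ℕ) (π : ℕ → ℕ) (k : ℕ) : ℕ :=
  if k < 2 * r then (if k % 2 = 0 then π (k / 2) else d + π (k / 2)) else k - r

section Conf

variable {d r : ℕ} (hrd : r ≤ d) {π : ℕ → ℕ} (hπ : ∀ j < r, π j < r)
  (hinj : ∀ i < r, ∀ j < r, π i = π j → i = j)

theorem pairOrder_two_mul (π : ℕ → ℕ) {j : ℕ} (hj : j < r) : pairOrder d r π (2 * j) = π j := by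
  unfold pairOrder
  rw [if_pos (by omega), if_pos (by omega), show 2 * j / 2 = j by omega]

theorem pairOrder_two_mul_add_one (π : ℕ → ℕ) {j : ℕ} (hj : j < r) :
    pairOrder d r π (2 * j + 1) = d + π j := by
  unfold pairOrder
  rw [if_pos (by omega), if_neg (by omega), show (2 * j + 1) / 2 = j by omega]

theorem pairOrder_of_le (π : ℕ → ℕ) {k : ℕ} (hk : 2 * r ≤ k) : pairOrder d r π k = k - r :=
  if_neg (by omega)

include hπ in
theorem pairOrder_lt {k : ℕ} (hk : k < d + r) : pairOrder d r π k < d + r := by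
  have := hπ (k / 2)
  unfold pairOrder
  split_ifs <;> omega

include hrd hπ hinj in
theorem pairOrder_injOn {k l : ℕ} (hk : k < d + r) (hl : l < d + r)
    (h : pairOrder d r π k = pairOrder d r π l) : k = l := by
  have h1 := hπ (k / 2)
  have h2 := hπ (l / 2)
  have h3 := hinj (k / 2)
  have h4 := fun h => h3 h (l / 2)
  unfold pairOrder at h
  split_ifs at h <;> omega

include hrd hπ hinj in
theorem permanent_confMatrix (x : Fin (d + r) → ℕ) (a : ℕ → Fin (d + r) → Prop)
    [∀ i, DecidablePred (a i)]
    (ha : ∀ k i, a k i ↔ x i ≤ pairOrder d r π k + 1 ∧ pairOrder d r π k + 1 ≤ x i + d - 1) :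
    permanent (confMatrix (d + r) d x) = (injTuples a (d + r)).card := by
  have hbij : Function.Injective fun k : Fin (d + r) =>
      (⟨pairOrder d r π k, pairOrder_lt hπ k.2⟩ : Fin (d + r)) := fun k l h =>
    Fin.ext (pairOrder_injOn hrd hπ hinj k.2 l.2 (Fin.mk.inj_iff.1 h))
  refine permanent_eq_card _ (fun i j => ?_)
    (Equiv.ofBijective _ (Finite.injective_iff_bijective.1 hbij)) a fun k i => ?_
  · unfold confMatrix
    split_ifs <;> simp
  · rw [ha, confMatrix]
    simp only [Equiv.ofBijective_apply, ite_eq_left_iff, zero_ne_one, imp_false, not_not]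

include hrd hπ hinj in
theorem permanent_confMatrix_le (hr : 0 < r) {x : Fin (d + r) → ℕ} (hx : ValidConf (d + r) d x) :
    permanent (confMatrix (d + r) d x) ≤
      (Finset.univ.filter fun i => x i ≤ π 0 + 1).card *
        (d + r - (Finset.univ.filter fun i => x i ≤ π 0 + 1).card) *
          (∏ j ∈ Finset.range (r - 1), maxProd (d + r - 2 * (j + 1))) * (d - r).factorial := by
  let a : ℕ → Fin (d + r) → Prop := fun k i =>
    x i ≤ pairOrder d r π k + 1 ∧ pairOrder d r π k + 1 ≤ x i + d - 1
  have hx' : ∀ i, 1 ≤ x i ∧ x i ≤ r + 1 := fun i => by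
    have := hx i
    omega
  have h0 : ∀ j < r, ∀ i, a (2 * j) i ↔ x i ≤ π j + 1 := by
    intro j hj i
    have h1 := hπ j hj
    have h2 := hx' i
    simp only [a, pairOrder_two_mul π hj]
    omega
  have h1 : ∀ j < r, ∀ i, a (2 * j + 1) i ↔ ¬ x i ≤ π j + 1 := by
    intro j hj i
    have h1 := hπ j hj
    have h2 := hx' i
    simp only [a, pairOrder_two_mul_add_one π hj]
    omega
  have h2 : ∀ k, 2 * r ≤ k → k < 2 * r + (d - r) → ∀ i, a k i := by
    intro k hk hk' i
    have h2 := hx' i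
    simp only [a, pairOrder_of_le π hk]
    omega
  rw [permanent_confMatrix hrd hπ hinj x a fun _ _ => Iff.rfl]
  have h3 := card_injTuples_add a h2 (by omega)
  rw [show 2 * r + (d - r) = d + r by omega] at h3
  rw [h3]
  refine Nat.mul_le_mul_right _ ?_
  have h4 := card_injTuples_le a (r - 1) fun j hj i => by
    rw [h0 j (by omega), h1 j (by omega)]
  have h5 : Finset.univ.filter (a 0) = Finset.univ.filter fun i => x i ≤ π 0 + 1 :=
    Finset.filter_congr fun i _ => h0 0 hr i
  rwa [h5, show r - 1 + 1 = r by omega] at h4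

end Conf

/-- The configuration whose first half starts in column `1` and second half in column `r + 1`. -/
def balancedConf (d r : ℕ) (i : Fin (d + r)) : ℕ := if (i : ℕ) < (d + r) / 2 then 1 else r + 1

theorem validConf_balancedConf (d r : ℕ) : ValidConf (d + r) d (balancedConf d r) := by
  intro i
  unfold balancedConf
  split_ifs <;> omega

theorem le_permanent_balancedConf {d r : ℕ} (hrd : r ≤ d) :
    (∏ j ∈ Finset.range r, maxProd (d + r - 2 * j)) * (d - r).factorial ≤
      permanent (confMatrix (d + r) d (balancedConf d r)) := by
  let a : ℕ → Fin (d + r) → Prop := fun k i =>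
    balancedConf d r i ≤ pairOrder d r id k + 1 ∧
      pairOrder d r id k + 1 ≤ balancedConf d r i + d - 1
  have h0 : ∀ j < r, ∀ i : Fin (d + r), (a (2 * j) i ↔ (i : ℕ) < (d + r) / 2) ∧
      (a (2 * j + 1) i ↔ ¬ (i : ℕ) < (d + r) / 2) := by
    intro j hj i
    simp only [a, pairOrder_two_mul id hj, pairOrder_two_mul_add_one id hj, balancedConf, id]
    split_ifs <;> omega
  have h2 : ∀ k, 2 * r ≤ k → k < 2 * r + (d - r) → ∀ i, a k i := by
    intro k hk hk' i
    simp only [a, pairOrder_of_le id hk, balancedConf]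
    split_ifs <;> omega
  rw [permanent_confMatrix hrd (π := id) (fun _ h => h) (fun _ _ _ _ h => h) _ a
    fun _ _ => Iff.rfl]
  have h3 := card_injTuples_add a h2 (by omega)
  rw [show 2 * r + (d - r) = d + r by omega] at h3
  rw [h3]
  refine Nat.mul_le_mul_right _ (le_card_injTuples a (fun i => (i : ℕ) < (d + r) / 2) ?_ r h0)
  rw [Fin.card_filter_val_lt]
  omega

theorem maxProd_le_of_optimal {d r : ℕ} (hr : 0 < r) (hrd : r ≤ d) {x : Fin (d + r) → ℕ}
    (hx : ValidConf (d + r) d x)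
    (hmax : permanent (confMatrix (d + r) d (balancedConf d r)) ≤
      permanent (confMatrix (d + r) d x))
    {π : ℕ → ℕ} (hπ : ∀ j < r, π j < r) (hinj : ∀ i < r, ∀ j < r, π i = π j → i = j) :
    maxProd (d + r) ≤ (Finset.univ.filter fun i => x i ≤ π 0 + 1).card *
      (d + r - (Finset.univ.filter fun i => x i ≤ π 0 + 1).card) := by
  have h := (le_permanent_balancedConf hrd).trans
    (hmax.trans (permanent_confMatrix_le hrd hπ hinj hr hx))
  have hsplit := Finset.prod_range_succ' (fun j => maxProd (d + r - 2 * j)) (r - 1)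
  rw [show r - 1 + 1 = r by omega] at hsplit
  have hpos : 0 < ∏ j ∈ Finset.range (r - 1), maxProd (d + r - 2 * (j + 1)) :=
    Finset.prod_pos fun j hj => maxProd_pos (by rw [Finset.mem_range] at hj; omega)
  have h' := Nat.le_of_mul_le_mul_right h (Nat.factorial_pos _)
  rw [hsplit, mul_comm] at h'
  exact Nat.le_of_mul_le_mul_right h' hpos

theorem le_of_monotone_of_lt_card {n : ℕ} {y : Fin n → ℕ} (hy : Monotone y) {c : ℕ} {i : Fin n}
    (hi : (i : ℕ) < (Finset.univ.filter fun j => y j ≤ c).card) : y i ≤ c := by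
  by_contra! h
  have hsub : (Finset.univ.filter fun j => y j ≤ c) ⊆ Finset.Iio i := by
    intro j hj
    simp only [Finset.mem_filter, Finset.mem_univ, true_and] at hj
    rw [Finset.mem_Iio]
    by_contra! hij
    exact absurd (hy hij) (by omega)
  have := Finset.card_le_card hsub
  rw [Fin.card_Iio] at this
  omega

theorem lt_of_monotone_of_card_le {n : ℕ} {y : Fin n → ℕ} (hy : Monotone y) {c : ℕ} {i : Fin n}
    (hi : (Finset.univ.filter fun j => y j ≤ c).card ≤ i) : c < y i := by
  by_contra! h
  have hsub : Finset.Iic i ⊆ (Finset.univ.filter fun j => y j ≤ c) := by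
    intro j hj
    rw [Finset.mem_Iic] at hj
    simpa using (hy hj).trans h
  have := Finset.card_le_card hsub
  rw [Fin.card_Iic] at this
  omega

/-- **Classification of optimal anticodes for `d > n/2`.**  Let `n = d + r` with
`0 < r ≤ d` and let `A ∈ M_n^d` (i.e. `A ∈ Γ_n^d` attains the maximum permanent).
Then, up to a permutation `σ` of the rows and `τ` of the columns, `A` has configuration
`(y₁,…,y_n)` with `y_i = 1` for `1 ≤ i ≤ ⌊n/2⌋` and `y_i = r + 1` for
`⌈n/2⌉ < i ≤ n` (for `n` odd, the middle value `y_{⌈n/2⌉}` is unconstrained). -/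
theorem classification_of_optimal (d r : ℕ) (hr : 0 < r) (hrd : r ≤ d)
    (A : Matrix (Fin (d + r)) (Fin (d + r)) ℕ) (hA : IsGamma (d + r) d A)
    (hmax : ∀ B : Matrix (Fin (d + r)) (Fin (d + r)) ℕ, IsGamma (d + r) d B →
      permanent B ≤ permanent A) :
    ∃ (σ τ : Equiv.Perm (Fin (d + r))) (y : Fin (d + r) → ℕ),
      ValidConf (d + r) d y ∧
      (fun i j => A (σ i) (τ j)) = confMatrix (d + r) d y ∧
      (∀ i : Fin (d + r), (i : ℕ) + 1 ≤ (d + r) / 2 → y i = 1) ∧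
      (∀ i : Fin (d + r), (d + r + 1) / 2 < (i : ℕ) + 1 → y i = r + 1) := by
  obtain ⟨x, hx, rfl⟩ := hA
  have hbal := hmax _ ⟨_, validConf_balancedConf d r, rfl⟩
  have hfirst := maxProd_le_of_optimal hr hrd hx hbal (π := id) (fun _ h => h)
    (fun _ _ _ _ h => h)
  have hlast := maxProd_le_of_optimal hr hrd hx hbal (π := fun j => r - 1 - j)
    (fun j hj => by omega) (fun i hi j hj h => by omega)
  have hle : ∀ c, (Finset.univ.filter fun i => x i ≤ c).card ≤ d + r := fun c => by
    simpa using Finset.card_le_univ (Finset.univ.filter fun i => x i ≤ c)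
  have hcard : ∀ c, (Finset.univ.filter fun i => (x ∘ Tuple.sort x) i ≤ c).card =
      (Finset.univ.filter fun i => x i ≤ c).card := fun c =>
    Finset.card_equiv (Tuple.sort x) (by simp)
  have hmono := Tuple.monotone_sort x
  refine ⟨Tuple.sort x, 1, x ∘ Tuple.sort x, fun i => hx _, rfl, fun i hi => ?_, fun i hi => ?_⟩
  · have h1 := half_le_of_maxProd_le (Nat.add_sub_cancel' (hle _)) hfirst
    have h2 := le_of_monotone_of_lt_card hmono (c := 1) (i := i) (by
      rw [hcard]
      simp only [id, zero_add] at h1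
      omega)
    have h3 := hx (Tuple.sort x i)
    simp only [Function.comp_apply] at h2 ⊢
    omega
  · rw [mul_comm] at hlast
    have h1 := half_le_of_maxProd_le (Nat.sub_add_cancel (hle _)) hlast
    have h2 := lt_of_monotone_of_card_le hmono (c := r) (i := i) (by
      rw [hcard]
      rw [show r - 1 - 0 + 1 = r by omega] at h1
      omega)
    have h3 := hx (Tuple.sort x i)
    simp only [Function.comp_apply] at h2 ⊢
    omega
end

section
/- Let d ≥ 1 and a ≥ d be integers, and let A = (a_{i,j}) ∈ Γ_a^d satisfy a_{i,i} = 1 for all i. Then there exists m(A) ∈ ℕ such that for every positive integer t with a + td > m(A) and every B = (b_{i,j}) ∈ Γ_{a+td}^d with b_{i,i} = 1 for all i which does not contain 1_{d×d} as a sub-matrix, one has per(A ⊕ t·1_{d×d}) > per(B), where A ⊕ t·1_{d×d} denotes the block-diagonal direct sum of A with t copies of 1_{d×d}. -/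
/-- `B` contains the all-ones `d × d` matrix as a sub-matrix: there are `d` rows and
`d` columns whose intersection entries are all `1`. -/
def ContainsAllOnes (d : ℕ) {n : ℕ} (B : Matrix (Fin n) (Fin n) ℕ) : Prop :=
  ∃ R S : Finset (Fin n), R.card = d ∧ S.card = d ∧ ∀ i ∈ R, ∀ j ∈ S, B i j = 1

/-- The block-diagonal direct sum `A ⊕ t·1_{d×d}` of an `a × a` matrix `A` with `t`
copies of the all-ones `d × d` matrix. -/
def directSumOnes (a d t : ℕ) (A : Matrix (Fin a) (Fin a) ℕ) :
    Matrix (Fin (a + t * d)) (Fin (a + t * d)) ℕ :=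
  fun i j =>
    if hi : (i : ℕ) < a then
      if hj : (j : ℕ) < a then A ⟨i, hi⟩ ⟨j, hj⟩ else 0
    else
      if a ≤ (j : ℕ) ∧ ((i : ℕ) - a) / d = ((j : ℕ) - a) / d then 1 else 0

/-- The number of elements of `K` that the ordering `π` does not place before `i`. -/
def laterCount {n : ℕ} (K : Finset (Fin n)) (i : Fin n) (π : Equiv.Perm (Fin n)) : ℕ :=
  (K.filter fun s => π i ≤ π s).card

theorem laterCount_pos {n : ℕ} {K : Finset (Fin n)} {i : Fin n} (hi : i ∈ K)
    (π : Equiv.Perm (Fin n)) : 0 < laterCount K i π :=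
  Finset.card_pos.mpr ⟨i, by simp [hi]⟩

theorem laterCount_le_card {n : ℕ} (K : Finset (Fin n)) (i : Fin n) (π : Equiv.Perm (Fin n)) :
    laterCount K i π ≤ K.card :=
  Finset.card_filter_le _ _

theorem laterCount_lt_of_lt {n : ℕ} {K : Finset (Fin n)} {i j : Fin n} (hi : i ∈ K)
    {π : Equiv.Perm (Fin n)} (hij : π i < π j) : laterCount K j π < laterCount K i π := by
  refine Finset.card_lt_card ⟨fun s hs => ?_, fun h => ?_⟩
  · simp only [Finset.mem_filter] at hs ⊢
    exact ⟨hs.1, hij.le.trans hs.2⟩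
  · have := h (show i ∈ _ by simp [hi])
    simp only [Finset.mem_filter] at this
    exact absurd this.2 (not_le.mpr hij)

theorem prod_laterCount {n : ℕ} (K : Finset (Fin n)) (π : Equiv.Perm (Fin n)) :
    ∏ i ∈ K, laterCount K i π = K.card.factorial := by
  have hinj : Set.InjOn (fun i => laterCount K i π) K := by
    intro i hi j hj h
    rcases lt_trichotomy (π i) (π j) with h1 | h1 | h1
    · exact absurd h (laterCount_lt_of_lt hi h1).ne'
    · exact π.injective h1
    · exact absurd h (laterCount_lt_of_lt hj h1).ne
  have himg : K.image (fun i => laterCount K i π) = Finset.Ico 1 (K.card + 1) := by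
    refine Finset.eq_of_subset_of_card_le (fun x hx => ?_) ?_
    · obtain ⟨i, hi, rfl⟩ := Finset.mem_image.mp hx
      exact Finset.mem_Ico.mpr ⟨laterCount_pos hi π, Nat.lt_succ_of_le (laterCount_le_card K i π)⟩
    · rw [Finset.card_image_of_injOn hinj]; simp
  rw [← Finset.prod_Ico_id_eq_factorial, ← himg, Finset.prod_image hinj]

theorem laterCount_mul_swap {n : ℕ} {K : Finset (Fin n)} {i j : Fin n} (hi : i ∈ K) (hj : j ∈ K)
    (π : Equiv.Perm (Fin n)) : laterCount K i (π * Equiv.swap i j) = laterCount K j π := by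
  have hmem : ∀ s ∈ K, Equiv.swap i j s ∈ K := by
    intro s hs
    rw [Equiv.swap_apply_def]
    split_ifs <;> assumption
  refine Finset.card_bij' (fun s _ => Equiv.swap i j s) (fun s _ => Equiv.swap i j s) ?_ ?_ ?_ ?_
  · intro s hs
    simp only [Finset.mem_filter, Equiv.Perm.mul_apply, Equiv.swap_apply_left] at hs ⊢
    exact ⟨hmem s hs.1, hs.2⟩
  · intro s hs
    simp only [Finset.mem_filter, Equiv.Perm.mul_apply, Equiv.swap_apply_left,
      Equiv.swap_apply_self] at hs ⊢
    exact ⟨hmem s hs.1, hs.2⟩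
  · intro s _; simp
  · intro s _; simp

theorem card_mul_sum_log_laterCount {n : ℕ} {K : Finset (Fin n)} {i : Fin n} (hi : i ∈ K) :
    (K.card : ℝ) * ∑ π : Equiv.Perm (Fin n), Real.log (laterCount K i π) =
      (n.factorial : ℝ) * Real.log (K.card.factorial) := by
  have hsym : ∀ j ∈ K, ∑ π : Equiv.Perm (Fin n), Real.log (laterCount K j π) =
      ∑ π : Equiv.Perm (Fin n), Real.log (laterCount K i π) := by
    intro j hj
    rw [← Equiv.sum_comp (Equiv.mulRight (Equiv.swap i j))
      (fun π => Real.log (laterCount K i π))]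
    simp only [Equiv.coe_mulRight, laterCount_mul_swap hi hj]
  calc (K.card : ℝ) * ∑ π : Equiv.Perm (Fin n), Real.log (laterCount K i π)
      = ∑ j ∈ K, ∑ π : Equiv.Perm (Fin n), Real.log (laterCount K j π) := by
        rw [Finset.sum_congr rfl hsym]; simp
    _ = ∑ π : Equiv.Perm (Fin n), Real.log (K.card.factorial) := by
        rw [Finset.sum_comm]
        refine Finset.sum_congr rfl fun π _ => ?_
        rw [← prod_laterCount K π, Nat.cast_prod, Real.log_prod]
        intro j hj
        exact_mod_cast (laterCount_pos hj π).ne'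
    _ = _ := by simp [Fintype.card_perm]

/-- Averaging a product over commuting permutations of the index set, each of which moves only
one of the factors. -/
theorem sum_mul_prod_eq_sum_mul_prod_average {X ω : Type*} [Fintype X] [DecidableEq ω]
    (s : ω → Equiv.Perm X) (hs : ∀ w w' x, s w (s w' x) = s w' (s w x)) (Z : ω → X → ℝ)
    (hZ : ∀ w w', w ≠ w' → ∀ x, Z w' (s w x) = Z w' x) (T : Finset ω) (C : X → ℝ)
    (hC : ∀ w ∈ T, ∀ x, C (s w x) = C x) :
    ∑ x, C x * ∏ w ∈ T, Z w x = ∑ x, C x * ∏ w ∈ T, (Z w x + Z w (s w x)) / 2 := by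
  induction T using Finset.induction_on generalizing C with
  | empty => simp
  | insert w T hw ih =>
    have h1 := ih (fun x => C x * Z w x) (by
      intro w' hw' x
      have : w' ≠ w := fun h => hw (h ▸ hw')
      simp only [hC w' (Finset.mem_insert_of_mem hw') x, hZ w' w this x])
    set G : X → ℝ := fun x => C x * ∏ w' ∈ T, (Z w' x + Z w' (s w' x)) / 2 with hG
    have hGs : ∀ x, G (s w x) = G x := by
      intro x
      simp only [hG, hC w (Finset.mem_insert_self w T) x]
      congr 1
      refine Finset.prod_congr rfl fun w' hw' => ?_
      have : w ≠ w' := fun h => hw (h ▸ hw')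
      rw [hs w' w x, hZ w w' this, hZ w w' this]
    have h2 : ∑ x, G x * Z w x = ∑ x, G x * Z w (s w x) := by
      rw [← Equiv.sum_comp (s w) (fun x => G x * Z w x)]
      simp only [hGs]
    calc ∑ x, C x * ∏ w' ∈ insert w T, Z w' x
        = ∑ x, C x * Z w x * ∏ w' ∈ T, Z w' x := by
          simp only [Finset.prod_insert hw, mul_assoc]
      _ = ∑ x, G x * Z w x := by
          rw [h1]
          exact Finset.sum_congr rfl fun x _ => by simp only [hG]; ring
      _ = (∑ x, G x * Z w x + ∑ x, G x * Z w (s w x)) / 2 := by rw [← h2]; ring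
      _ = _ := by
          rw [← Finset.sum_add_distrib, Finset.sum_div]
          refine Finset.sum_congr rfl fun x _ => ?_
          rw [Finset.prod_insert hw]; simp only [hG]; ring

theorem log_average_ge {x y δ : ℝ} (hx : 0 < x) (hy : 0 < y) (hδ : 0 ≤ δ)
    (h : (1 + δ) * (4 * x * y) ≤ (x + y) ^ 2) :
    (Real.log x + Real.log y) / 2 + Real.log (1 + δ) / 2 ≤ Real.log ((x + y) / 2) := by
  have h1 : Real.log ((1 + δ) * (x * y)) ≤ Real.log (((x + y) / 2) ^ 2) :=
    Real.log_le_log (by positivity) (by nlinarith)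
  rw [Real.log_pow, Real.log_mul (by positivity) (by positivity),
    Real.log_mul hx.ne' hy.ne'] at h1
  push_cast at h1
  linarith

theorem exists_equiv_strictMono {α : Type*} [Fintype α] (f : α → ℕ) (hf : f.Injective) :
    ∃ e : Fin (Fintype.card α) ≃ α, StrictMono (f ∘ e) := by
  let e₀ := (Fintype.equivFin α).symm
  refine ⟨(Tuple.sort (f ∘ e₀)).trans e₀, ?_⟩
  exact (Tuple.monotone_sort (f ∘ e₀)).strictMono_of_injective
    (hf.comp (((Tuple.sort (f ∘ e₀)).trans e₀).injective))

theorem exists_perm_subtype_lt {n : ℕ} (V : Finset (Fin n)) (ρ : Fin n → ℕ) (hρ : ρ.Injective)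
    (π : Equiv.Perm (Fin n)) : ∃ g : Equiv.Perm {x // x ∈ V}, ∀ r ∈ V, ∀ s ∈ V, ρ r < ρ s →
      (π * Equiv.Perm.ofSubtype g) r < (π * Equiv.Perm.ofSubtype g) s := by
  obtain ⟨e, he⟩ := exists_equiv_strictMono (fun x : {x // x ∈ V} => ρ x)
    (hρ.comp Subtype.val_injective)
  obtain ⟨e', he'⟩ := exists_equiv_strictMono (fun x : {x // x ∈ V} => (π x : ℕ))
    (Fin.val_injective.comp (π.injective.comp Subtype.val_injective))
  refine ⟨e.symm.trans e', fun r hr s hs hrs => ?_⟩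
  have h : e.symm ⟨r, hr⟩ < e.symm ⟨s, hs⟩ := by
    rw [← he.lt_iff_lt]; simpa using hrs
  have := he' h
  simpa [Equiv.Perm.ofSubtype_apply_of_mem _ hr, Equiv.Perm.ofSubtype_apply_of_mem _ hs] using this

theorem factorial_le_factorial_mul_card {n : ℕ} (V : Finset (Fin n))
    (P : Equiv.Perm (Fin n) → Prop) [DecidablePred P]
    (h : ∀ π, ∃ g : Equiv.Perm {x // x ∈ V}, P (π * Equiv.Perm.ofSubtype g)) :
    n.factorial ≤ V.card.factorial * (Finset.univ.filter P).card := by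
  calc n.factorial = ∑ π : Equiv.Perm (Fin n), 1 := by simp [Fintype.card_perm]
    _ ≤ ∑ π : Equiv.Perm (Fin n), ∑ g : Equiv.Perm {x // x ∈ V},
        if P (π * Equiv.Perm.ofSubtype g) then 1 else 0 := by
        refine Finset.sum_le_sum fun π _ => ?_
        obtain ⟨g, hg⟩ := h π
        have := Finset.single_le_sum (f := fun g : Equiv.Perm {x // x ∈ V} =>
          if P (π * Equiv.Perm.ofSubtype g) then 1 else 0) (fun _ _ => Nat.zero_le _)
          (Finset.mem_univ g)
        simpa [hg] using this
    _ = ∑ g : Equiv.Perm {x // x ∈ V}, (Finset.univ.filter P).card := by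
        rw [Finset.sum_comm]
        refine Finset.sum_congr rfl fun g _ => ?_
        rw [Finset.card_filter]
        exact Equiv.sum_comp (Equiv.mulRight (Equiv.Perm.ofSubtype g))
          (fun π => if P π then 1 else 0)
    _ = _ := by simp [Fintype.card_perm]

/-- For every processing order of the rows, the greedy uniform choice of unused columns assigns
total mass at most one to the functions it can produce. -/
theorem sum_prod_inv_available_le_one {β : Type*} [Fintype β] [DecidableEq β] (n : ℕ)
    (S : Fin n → Finset β) :
    ∑ f : Fin n → β, ∏ i, (if f i ∈ S i \ (Finset.univ.filter (· < i)).image f then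
      ((S i \ (Finset.univ.filter (· < i)).image f).card : ℝ)⁻¹ else 0) ≤ 1 := by
  induction n with
  | zero => simp
  | succ n ih =>
    refine le_trans ?_ (ih fun i => S i.castSucc)
    rw [← (Fin.snocEquiv fun _ => β).sum_comp, Fintype.sum_prod_type, Finset.sum_comm]
    refine Finset.sum_le_sum fun f _ => ?_
    have himg : ∀ (c : β) (i : Fin n),
        (Finset.univ.filter (· < i.castSucc)).image (Fin.snoc f c : Fin (n + 1) → β) =
          (Finset.univ.filter (· < i)).image f := by
      intro c i
      ext b
      simp only [Finset.mem_image, Finset.mem_filter, Finset.mem_univ, true_and]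
      constructor
      · rintro ⟨k, hk, rfl⟩
        refine ⟨⟨k, by have := Fin.lt_def.mp hk; simp at this; omega⟩, hk, ?_⟩
        have : k = Fin.castSucc ⟨k, by have := Fin.lt_def.mp hk; simp at this; omega⟩ := rfl
        conv_rhs => rw [this, Fin.snoc_castSucc (α := fun _ => β)]
      · rintro ⟨k, hk, rfl⟩
        exact ⟨k.castSucc, by simpa using hk, by simp⟩
    have hlast : ∀ c : β,
        (Finset.univ.filter (· < Fin.last n)).image (Fin.snoc f c : Fin (n + 1) → β) =
          Finset.univ.image f := by
      intro c
      ext b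
      simp only [Finset.mem_image, Finset.mem_filter, Finset.mem_univ, true_and]
      constructor
      · rintro ⟨k, hk, rfl⟩
        obtain ⟨k, rfl⟩ := Fin.exists_castSucc_eq.mpr hk.ne
        exact ⟨k, by simp⟩
      · rintro ⟨k, rfl⟩
        exact ⟨k.castSucc, Fin.castSucc_lt_last k, by simp⟩
    simp only [Fin.snocEquiv, Equiv.coe_fn_mk, Fin.prod_univ_castSucc, Fin.snoc_castSucc,
      Fin.snoc_last, himg, hlast]
    rw [← Finset.mul_sum]
    refine mul_le_of_le_one_right (Finset.prod_nonneg fun i _ => by split_ifs <;> positivity) ?_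
    rw [← Finset.sum_filter, Finset.sum_const, Finset.filter_mem_eq_inter, Finset.univ_inter,
      nsmul_eq_mul]
    exact mul_inv_le_one

/-- The orderings which, restricted to `V`, place everything outside `K` first, then `p`,
then `q`, and then the rest of `K`. -/
def IsSplitOrder {n : ℕ} (K V : Finset (Fin n)) (p q : Fin n) (π : Equiv.Perm (Fin n)) : Prop :=
  π p < π q ∧ ∀ r ∈ V, r ≠ p → r ≠ q →
    (r ∈ K → π q < π r) ∧ (r ∉ K → π r < π p)

theorem exists_isSplitOrder {n : ℕ} {K V : Finset (Fin n)} {p q : Fin n} (hpq : p ≠ q)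
    (hp : p ∈ V) (hq : q ∈ V) (π : Equiv.Perm (Fin n)) :
    ∃ g : Equiv.Perm {x // x ∈ V}, IsSplitOrder K V p q (π * Equiv.Perm.ofSubtype g) := by
  let c : Fin n → ℕ := fun r => if r = p then 1 else if r = q then 2 else if r ∈ K then 3 else 0
  let ρ : Fin n → ℕ := fun r => r + n * c r
  have hρ : ρ.Injective := by
    intro r s h
    have := congrArg (· % n) h
    simp only [ρ, Nat.add_mul_mod_self_left, Nat.mod_eq_of_lt r.2, Nat.mod_eq_of_lt s.2] at this
    exact Fin.ext this
  have hlt : ∀ r s, c r < c s → ρ r < ρ s := by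
    intro r s h
    have h1 : n * (c r + 1) ≤ n * c s := Nat.mul_le_mul_left _ h
    have h2 := r.2
    simp only [ρ]
    rw [mul_add] at h1
    omega
  obtain ⟨g, hg⟩ := exists_perm_subtype_lt V ρ hρ π
  refine ⟨g, hg p hp q hq (hlt _ _ (by simp [c, hpq.symm])), fun r hr hrp hrq => ⟨fun hK => ?_,
    fun hK => ?_⟩⟩
  · exact hg q hq r hr (hlt _ _ (by simp [c, hpq.symm, hrp, hrq, hK]))
  · exact hg r hr p hp (hlt _ _ (by simp [c, hrp, hrq, hK]))

theorem laterCount_mul_swap_of_notMem {n : ℕ} {K : Finset (Fin n)} {p q r : Fin n}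
    (hp : p ∉ K) (hq : q ∉ K) (hrp : r ≠ p) (hrq : r ≠ q) (π : Equiv.Perm (Fin n)) :
    laterCount K r (π * Equiv.swap p q) = laterCount K r π := by
  unfold laterCount
  congr 1
  refine Finset.filter_congr fun s hs => ?_
  have h1 : s ≠ p := fun h => hp (h ▸ hs)
  have h2 : s ≠ q := fun h => hq (h ▸ hs)
  simp [Equiv.swap_apply_of_ne_of_ne hrp hrq, Equiv.swap_apply_of_ne_of_ne h1 h2]

theorem IsSplitOrder.laterCount_mul_swap {n : ℕ} {K K' V : Finset (Fin n)} {p q r : Fin n}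
    {π : Equiv.Perm (Fin n)} (h : IsSplitOrder K V p q π) (hr : r ∈ V) (hrp : r ≠ p)
    (hrq : r ≠ q) : laterCount K' r (π * Equiv.swap p q) = laterCount K' r π := by
  unfold laterCount
  congr 1
  refine Finset.filter_congr fun s hs => ?_
  have hπ : (π * Equiv.swap p q) r = π r := by
    simp [Equiv.swap_apply_of_ne_of_ne hrp hrq]
  rw [hπ]
  have h1 := h.1
  have h2 := h.2 r hr hrp hrq
  have key : π r ≤ π p ↔ π r ≤ π q := by
    by_cases hK : r ∈ K
    · have := h2.1 hK
      constructor <;> intro h' <;> order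
    · have := h2.2 hK
      constructor <;> intro _ <;> order
  by_cases hsp : s = p
  · subst hsp; simp [key]
  by_cases hsq : s = q
  · subst hsq; simp [key]
  · simp [Equiv.swap_apply_of_ne_of_ne hsp hsq]

/-- In a split order, exchanging the two adjacent elements changes the product of their
later counts. -/
theorem IsSplitOrder.mul_laterCount_ne {n : ℕ} {K K' V : Finset (Fin n)} {p q : Fin n}
    {π : Equiv.Perm (Fin n)} (h : IsSplitOrder K V p q π) (hKV : K ⊆ V) (hKV' : K' ⊆ V)
    (hp : p ∈ K) (hq : q ∈ K) (hq' : q ∈ K') (hcard : K.card = K'.card) (hne : K ≠ K') :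
    laterCount K p π * laterCount K' q π ≠
      laterCount K p (π * Equiv.swap p q) * laterCount K' q (π * Equiv.swap p q) := by
  have hpq : p ≠ q := fun e => by simpa [e] using h.1
  have h1 : laterCount K p π = K.card := by
    unfold laterCount
    rw [Finset.filter_true_of_mem]
    intro s hs
    by_cases hsp : s = p
    · rw [hsp]
    by_cases hsq : s = q
    · rw [hsq]; exact h.1.le
    · exact (h.1.trans ((h.2 s (hKV hs) hsp hsq).1 hs)).le
  have h2 : laterCount K p (π * Equiv.swap p q) = K.card - 1 := by
    unfold laterCount
    rw [← Finset.card_erase_of_mem hq]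
    congr 1
    ext s
    simp only [Finset.mem_filter, Finset.mem_erase, Equiv.Perm.mul_apply, Equiv.swap_apply_left]
    constructor
    · rintro ⟨hs, hle⟩
      refine ⟨?_, hs⟩
      rintro rfl
      rw [Equiv.swap_apply_right] at hle
      exact absurd h.1 (not_lt.mpr hle)
    · rintro ⟨hsq, hs⟩
      refine ⟨hs, ?_⟩
      by_cases hsp : s = p
      · simp [hsp]
      · rw [Equiv.swap_apply_of_ne_of_ne hsp hsq]
        exact ((h.2 s (hKV hs) hsp hsq).1 hs).le
  have h3 : laterCount K' q π = ((K' ∩ K).erase p).card := by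
    unfold laterCount
    congr 1
    ext s
    simp only [Finset.mem_filter, Finset.mem_erase, Finset.mem_inter]
    constructor
    · rintro ⟨hs, hle⟩
      have hsp : s ≠ p := by rintro rfl; exact absurd h.1 (not_lt.mpr hle)
      refine ⟨hsp, hs, ?_⟩
      by_contra hK
      by_cases hsq : s = q
      · exact hK (hsq ▸ hq)
      · have := (h.2 s (hKV' hs) hsp hsq).2 hK
        exact absurd (this.trans h.1) (not_lt.mpr hle)
    · rintro ⟨hsp, hs, hK⟩
      refine ⟨hs, ?_⟩
      by_cases hsq : s = q
      · rw [hsq]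
      · exact ((h.2 s (hKV hK) hsp hsq).1 hK).le
  have h4 : laterCount K' q (π * Equiv.swap p q) = (K' ∩ K).card := by
    unfold laterCount
    congr 1
    ext s
    simp only [Finset.mem_filter, Finset.mem_inter, Equiv.Perm.mul_apply, Equiv.swap_apply_right]
    constructor
    · rintro ⟨hs, hle⟩
      refine ⟨hs, ?_⟩
      by_contra hK
      have hsp : s ≠ p := fun e => hK (e ▸ hp)
      have hsq : s ≠ q := fun e => hK (e ▸ hq)
      rw [Equiv.swap_apply_of_ne_of_ne hsp hsq] at hle
      exact absurd ((h.2 s (hKV' hs) hsp hsq).2 hK) (not_lt.mpr hle)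
    · rintro ⟨hs, hK⟩
      refine ⟨hs, ?_⟩
      by_cases hsp : s = p
      · subst hsp; rw [Equiv.swap_apply_left]; exact h.1.le
      by_cases hsq : s = q
      · subst hsq; simp
      · rw [Equiv.swap_apply_of_ne_of_ne hsp hsq]
        exact (h.1.trans ((h.2 s (hKV hK) hsp hsq).1 hK)).le
  have hlt : (K' ∩ K).card < K.card := by
    refine Finset.card_lt_card ⟨Finset.inter_subset_right, fun hs => hne ?_⟩
    exact Finset.eq_of_subset_of_card_le (fun x hx => (Finset.mem_inter.mp (hs hx)).1) hcard.ge
  have hpos : 0 < (K' ∩ K).card := Finset.card_pos.mpr ⟨q, by simp [hq, hq']⟩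
  rw [h1, h2, h3, h4]
  obtain ⟨k, hk⟩ : ∃ k, K.card = k + 1 := ⟨K.card - 1, by omega⟩
  by_cases hp' : p ∈ K'
  · rw [Finset.card_erase_of_mem (by simp [hp, hp'])]
    obtain ⟨b, hb⟩ : ∃ b, (K' ∩ K).card = b + 1 := ⟨(K' ∩ K).card - 1, by omega⟩
    rw [hk, hb] at hlt ⊢
    simp only [Nat.add_sub_cancel]
    intro h
    have : b = k := by linarith [h, add_mul k 1 b, mul_add k b 1]
    omega
  · rw [Finset.erase_eq_of_notMem (by simp [hp']), hk]
    simp only [Nat.add_sub_cancel]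
    intro h
    rw [add_mul] at h
    omega

theorem card_mul_exp_le_sum_exp {X : Type*} [Fintype X] (L : X → ℝ) (M : ℝ)
    (h : Fintype.card X * M ≤ ∑ x, L x) : Fintype.card X * Real.exp M ≤ ∑ x, Real.exp (L x) := by
  have h1 : ∀ x, Real.exp M * (1 + (L x - M)) ≤ Real.exp (L x) := by
    intro x
    have := Real.add_one_le_exp (L x - M)
    calc Real.exp M * (1 + (L x - M)) ≤ Real.exp M * Real.exp (L x - M) := by
          gcongr; linarith
      _ = Real.exp (L x) := by rw [← Real.exp_add]; congr 1; ring
  refine le_trans ?_ (Finset.sum_le_sum fun x _ => h1 x)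
  rw [← Finset.mul_sum, Finset.sum_add_distrib, Finset.sum_sub_distrib]
  simp only [Finset.sum_const, Finset.card_univ, nsmul_eq_mul, mul_one]
  rw [mul_comm]
  gcongr
  linarith

theorem log_average_div_ge {z : ℝ} (hz : 0 < z) {P Q M : ℕ} (hP : 0 < P) (hQ : 0 < Q)
    (hPM : P ≤ M) (hQM : Q ≤ M) (hne : P ≠ Q) :
    (Real.log (z * (P : ℝ)⁻¹) + Real.log (z * (Q : ℝ)⁻¹)) / 2 +
        Real.log (1 + 1 / (4 * (M : ℝ) ^ 2)) / 2 ≤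
      Real.log ((z * (P : ℝ)⁻¹ + z * (Q : ℝ)⁻¹) / 2) := by
  have hP' : (0 : ℝ) < P := by exact_mod_cast hP
  have hQ' : (0 : ℝ) < Q := by exact_mod_cast hQ
  have hM' : (0 : ℝ) < M := by exact_mod_cast hP.trans_le hPM
  refine log_average_ge (by positivity) (by positivity) (by positivity) ?_
  have h1 : (1 : ℝ) ≤ ((P : ℝ) - Q) ^ 2 := by
    have : (1 : ℤ) ≤ ((P : ℤ) - Q) ^ 2 := by
      have : (P : ℤ) - Q ≠ 0 := by omega
      have := sq_nonneg ((P : ℤ) - Q)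
      have h2 : ((P : ℤ) - Q) ^ 2 ≠ 0 := by positivity
      omega
    exact_mod_cast this
  have h2 : (P : ℝ) * Q ≤ (M : ℝ) ^ 2 := by
    rw [sq]
    have : P * Q ≤ M * M := Nat.mul_le_mul hPM hQM
    exact_mod_cast this
  have h3 : 1 / (4 * (M : ℝ) ^ 2) * (4 * (P * Q)) ≤ 1 := by
    rw [div_mul_eq_mul_div, div_le_one (by positivity)]; linarith
  have h4 : (1 + 1 / (4 * (M : ℝ) ^ 2)) * (4 * (P * Q)) ≤ ((P : ℝ) + Q) ^ 2 := by nlinarith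
  have e1 : (1 + 1 / (4 * (M : ℝ) ^ 2)) * (4 * (z * (P : ℝ)⁻¹) * (z * (Q : ℝ)⁻¹)) =
      ((1 + 1 / (4 * (M : ℝ) ^ 2)) * (4 * (P * Q))) * (z / (P * Q)) ^ 2 := by
    field_simp
  have e2 : (z * (P : ℝ)⁻¹ + z * (Q : ℝ)⁻¹) ^ 2 = ((P : ℝ) + Q) ^ 2 * (z / (P * Q)) ^ 2 := by
    field_simp; ring
  rw [e1, e2]
  gcongr

/-- A lower bound for the average, over all orderings, of the reciprocals of the products of the
later counts. Each of the `m` pairs `p w, q w`, which live in disjoint regions `V w` of bounded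
size, contributes a definite gain over the bound given by the geometric mean. -/
theorem factorial_mul_exp_le_sum_prod_inv_laterCount {n d v m : ℕ} (hd : 0 < d)
    (K : Fin n → Finset (Fin n)) (hmem : ∀ i, i ∈ K i) (hcard : ∀ i, (K i).card = d)
    (p q : Fin m → Fin n) (V : Fin m → Finset (Fin n)) (hq : ∀ w, q w ∈ K (p w))
    (hne : ∀ w, K (p w) ≠ K (q w)) (hV : ∀ w w', w ≠ w' → Disjoint (V w) (V w'))
    (hout : ∀ w r, r ∉ V w → p w ∉ K r ∧ q w ∉ K r) (hpV : ∀ w, K (p w) ⊆ V w)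
    (hqV : ∀ w, K (q w) ⊆ V w) (hv : ∀ w, (V w).card ≤ v) :
    (n.factorial : ℝ) * Real.exp (-(n * (Real.log d.factorial / d)) +
        m * (Real.log (1 + 1 / (4 * ((d * d : ℕ) : ℝ) ^ 2)) / 2 / v.factorial)) ≤
      ∑ π : Equiv.Perm (Fin n), ∏ i, (laterCount (K i) i π : ℝ)⁻¹ := by
  classical
  set ε : ℝ := Real.log (1 + 1 / (4 * ((d * d : ℕ) : ℝ) ^ 2)) / 2 with hε
  have hε0 : 0 ≤ ε := div_nonneg (Real.log_nonneg (le_add_of_nonneg_right (by positivity)))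
    (by norm_num)
  set u : Fin n → Equiv.Perm (Fin n) → ℝ := fun r π => (laterCount (K r) r π : ℝ)⁻¹ with hu
  have hu0 : ∀ r π, 0 < u r π := fun r π => by
    have := laterCount_pos (hmem r) π
    simp only [hu]; positivity
  have hp : ∀ w, p w ∈ V w := fun w => hpV w (hmem _)
  have hqmem : ∀ w, q w ∈ V w := fun w => hqV w (hmem _)
  have hpq : ∀ w, p w ≠ q w := fun w h => hne w (by rw [h])
  set s : Fin m → Equiv.Perm (Equiv.Perm (Fin n)) :=
    fun w => Equiv.mulRight (Equiv.swap (p w) (q w)) with hs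
  have hsapp : ∀ w π, s w π = π * Equiv.swap (p w) (q w) := fun w π => rfl
  have husw : ∀ w r, r ∉ V w → ∀ π, u r (s w π) = u r π := by
    intro w r hr π
    simp only [hu, hsapp]
    rw [laterCount_mul_swap_of_notMem (hout w r hr).1 (hout w r hr).2
      (by rintro rfl; exact hr (hp w)) (by rintro rfl; exact hr (hqmem w))]
  set Z : Fin m → Equiv.Perm (Fin n) → ℝ := fun w π => ∏ r ∈ V w, u r π with hZ
  set U : Finset (Fin n) := Finset.univ.biUnion V with hU
  set C : Equiv.Perm (Fin n) → ℝ := fun π => ∏ r ∈ Uᶜ, u r π with hC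
  have hZ0 : ∀ w π, 0 < Z w π := fun w π => Finset.prod_pos fun r _ => hu0 r π
  have hC0 : ∀ π, 0 < C π := fun π => Finset.prod_pos fun r _ => hu0 r π
  have hfactor : ∀ π, ∏ i, u i π = C π * ∏ w, Z w π := by
    intro π
    rw [← Finset.prod_compl_mul_prod U, hU, Finset.prod_biUnion]
    intro w _ w' _ h
    exact hV w w' h
  have hcomm : ∀ w w' π, s w (s w' π) = s w' (s w π) := by
    intro w w' π
    by_cases h : w = w'
    · rw [h]
    have hdis := Finset.disjoint_left.mp (hV w w' h)
    have : Commute (Equiv.swap (p w) (q w)) (Equiv.swap (p w') (q w')) := by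
      refine (Equiv.Perm.disjoint_swap_swap ?_).commute
      have h1 : p w ≠ p w' := fun e => hdis (hp w) (e ▸ hp w')
      have h2 : p w ≠ q w' := fun e => hdis (hp w) (e ▸ hqmem w')
      have h3 : q w ≠ p w' := fun e => hdis (hqmem w) (e ▸ hp w')
      have h4 : q w ≠ q w' := fun e => hdis (hqmem w) (e ▸ hqmem w')
      simp [h1, h2, h3, h4, hpq]
    simp only [hsapp, mul_assoc, this.eq]
  have havg := sum_mul_prod_eq_sum_mul_prod_average s hcomm Z
    (fun w w' h π => Finset.prod_congr rfl fun r hr =>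
      husw w r (Finset.disjoint_right.mp (hV w w' h) hr) π)
    Finset.univ C
    (fun w _ π => Finset.prod_congr rfl fun r hr => husw w r (fun h => by
      simp only [hU, Finset.mem_compl, Finset.mem_biUnion, Finset.mem_univ, true_and,
        not_exists] at hr
      exact hr w h) π)
  have hsum : ∑ π : Equiv.Perm (Fin n), (Real.log (C π) + ∑ w, Real.log (Z w π)) =
      n.factorial * -(n * (Real.log d.factorial / d)) := by
    have h1 : ∀ π, Real.log (C π) + ∑ w, Real.log (Z w π) =
        -∑ i, Real.log (laterCount (K i) i π) := by
      intro π
      rw [← Real.log_prod (fun w _ => (hZ0 w π).ne'),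
        ← Real.log_mul (hC0 π).ne' (Finset.prod_pos fun w _ => hZ0 w π).ne', ← hfactor,
        Real.log_prod (fun i _ => (hu0 i π).ne'), ← Finset.sum_neg_distrib]
      exact Finset.sum_congr rfl fun i _ => Real.log_inv _
    have h2 : ∀ i, ∑ π : Equiv.Perm (Fin n), Real.log (laterCount (K i) i π) =
        n.factorial * (Real.log d.factorial / d) := by
      intro i
      have := card_mul_sum_log_laterCount (hmem i)
      rw [hcard i] at this
      have hd' : (d : ℝ) ≠ 0 := by positivity
      field_simp
      linarith
    simp only [h1, Finset.sum_neg_distrib]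
    rw [Finset.sum_comm]
    simp only [h2, Finset.sum_const, Finset.card_univ, Fintype.card_fin, nsmul_eq_mul]
    ring
  have hgain : ∀ w π, IsSplitOrder (K (p w)) (V w) (p w) (q w) π →
      (Real.log (Z w π) + Real.log (Z w (s w π))) / 2 + ε ≤
        Real.log ((Z w π + Z w (s w π)) / 2) := by
    intro w π hπ
    set R := ((V w).erase (p w)).erase (q w) with hR
    have hsplit : ∀ π', Z w π' = (∏ r ∈ R, u r π') *
        ((laterCount (K (p w)) (p w) π' * laterCount (K (q w)) (q w) π' : ℕ) : ℝ)⁻¹ := by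
      intro π'
      simp only [hZ]
      rw [← Finset.mul_prod_erase _ _ (hp w), ← Finset.mul_prod_erase _ _
        (Finset.mem_erase.mpr ⟨(hpq w).symm, hqmem w⟩)]
      simp only [hu, Nat.cast_mul, mul_inv]
      ring
    have hRs : ∏ r ∈ R, u r (s w π) = ∏ r ∈ R, u r π := by
      refine Finset.prod_congr rfl fun r hr => ?_
      simp only [hR, Finset.mem_erase] at hr
      simp only [hu, hsapp]
      rw [hπ.laterCount_mul_swap hr.2.2 hr.2.1 hr.1]
    rw [hsplit, hsplit, hRs]
    have hle : ∀ r π', laterCount (K r) r π' ≤ d := fun r π' =>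
      (laterCount_le_card _ _ _).trans (hcard r).le
    exact log_average_div_ge (Finset.prod_pos fun r _ => hu0 r π)
      (Nat.mul_pos (laterCount_pos (hmem _) _) (laterCount_pos (hmem _) _))
      (Nat.mul_pos (laterCount_pos (hmem _) _) (laterCount_pos (hmem _) _))
      (Nat.mul_le_mul (hle _ _) (hle _ _)) (Nat.mul_le_mul (hle _ _) (hle _ _))
      (hπ.mul_laterCount_ne (hpV w) (hqV w) (hmem _) (hq w) (hmem _)
        ((hcard _).trans (hcard _).symm) (hne w))
  have hpair : ∀ w, ∑ π, Real.log (Z w π) + n.factorial * (ε / v.factorial) ≤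
      ∑ π, Real.log ((Z w π + Z w (s w π)) / 2) := by
    intro w
    have hcnt := factorial_le_factorial_mul_card (V w)
      (IsSplitOrder (K (p w)) (V w) (p w) (q w))
      (exists_isSplitOrder (hpq w) (hp w) (hqmem w))
    set c := (Finset.univ.filter (IsSplitOrder (K (p w)) (V w) (p w) (q w))).card with hc
    have hcnt' : (n.factorial : ℝ) ≤ v.factorial * c := by
      exact_mod_cast hcnt.trans (Nat.mul_le_mul_right _ (Nat.factorial_le (hv w)))
    have h1 : (n.factorial : ℝ) * (ε / v.factorial) ≤ c * ε := by
      rw [mul_div_assoc', div_le_iff₀ (by positivity)]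
      nlinarith
    have h2 : ∑ π, Real.log (Z w (s w π)) = ∑ π, Real.log (Z w π) :=
      Equiv.sum_comp (s w) fun π => Real.log (Z w π)
    have h3 : ∑ π, ((Real.log (Z w π) + Real.log (Z w (s w π))) / 2 +
        if IsSplitOrder (K (p w)) (V w) (p w) (q w) π then ε else 0) =
        ∑ π, Real.log (Z w π) + c * ε := by
      rw [Finset.sum_add_distrib, ← Finset.sum_div, Finset.sum_add_distrib, h2,
        ← Finset.sum_filter, Finset.sum_const, nsmul_eq_mul]
      ring
    calc _ ≤ ∑ π, Real.log (Z w π) + c * ε := by linarith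
      _ ≤ _ := by
        rw [← h3]
        refine Finset.sum_le_sum fun π _ => ?_
        split_ifs with hg
        · exact hgain w π hg
        · have := log_average_ge (hZ0 w π) (hZ0 w (s w π)) le_rfl
            (by nlinarith [sq_nonneg (Z w π - Z w (s w π))])
          simpa using this
  have hA0 : ∀ w π, 0 < (Z w π + Z w (s w π)) / 2 := fun w π => by
    have := hZ0 w π
    have := hZ0 w (s w π)
    positivity
  calc (n.factorial : ℝ) * Real.exp (-(n * (Real.log d.factorial / d)) +
        m * (ε / v.factorial))
      ≤ ∑ π, Real.exp (Real.log (C π) + ∑ w, Real.log ((Z w π + Z w (s w π)) / 2)) := by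
        have hX : Fintype.card (Equiv.Perm (Fin n)) = n.factorial := by simp [Fintype.card_perm]
        rw [← hX]
        refine card_mul_exp_le_sum_exp _ _ ?_
        rw [hX, Finset.sum_add_distrib, Finset.sum_comm]
        rw [Finset.sum_add_distrib, Finset.sum_comm] at hsum
        have := Finset.sum_le_sum fun w (_ : w ∈ Finset.univ) => hpair w
        rw [Finset.sum_add_distrib] at this
        simp only [Finset.sum_const, Finset.card_univ, Fintype.card_fin, nsmul_eq_mul] at this
        linarith
    _ = ∑ π, C π * ∏ w, (Z w π + Z w (s w π)) / 2 := by
        refine Finset.sum_congr rfl fun π _ => ?_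
        rw [← Real.log_prod (fun w _ => (hA0 w π).ne'), Real.exp_add, Real.exp_log (hC0 π),
          Real.exp_log (Finset.prod_pos fun w _ => hA0 w π)]
    _ = ∑ π, ∏ i, u i π := by
        rw [← havg]
        exact Finset.sum_congr rfl fun π _ => (hfactor π).symm

theorem sum_prod_inv_laterCount_le_one {n : ℕ} (S : Fin n → Finset (Fin n))
    (π : Equiv.Perm (Fin n)) :
    ∑ σ ∈ Finset.univ.filter (fun σ : Equiv.Perm (Fin n) => ∀ i, σ i ∈ S i),
      ∏ i, (laterCount (Finset.univ.filter fun k => σ k ∈ S i) i π : ℝ)⁻¹ ≤ 1 := by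
  refine le_trans ?_ (sum_prod_inv_available_le_one n fun j => S (π.symm j))
  set w : (Fin n → Fin n) → ℝ := fun f => ∏ j,
    (if f j ∈ S (π.symm j) \ (Finset.univ.filter (· < j)).image f then
      ((S (π.symm j) \ (Finset.univ.filter (· < j)).image f).card : ℝ)⁻¹ else 0) with hw
  set φ : Equiv.Perm (Fin n) → (Fin n → Fin n) := fun σ j => σ (π.symm j) with hφ
  have hφinj : φ.Injective := by
    intro σ τ h
    ext1 i
    simpa [hφ] using congrFun h (π i)
  have hterm : ∀ σ ∈ Finset.univ.filter (fun σ : Equiv.Perm (Fin n) => ∀ i, σ i ∈ S i),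
      ∏ i, (laterCount (Finset.univ.filter fun k => σ k ∈ S i) i π : ℝ)⁻¹ = w (φ σ) := by
    intro σ hσ
    have hσ' : ∀ i, σ i ∈ S i := by simpa using hσ
    simp only [hw]
    refine Eq.trans (Finset.prod_congr rfl fun i _ => ?_) (Equiv.prod_comp π _)
    have himg : ∀ k, σ k ∈ (Finset.univ.filter (· < π i)).image (φ σ) ↔ π k < π i := by
      intro k
      simp only [hφ, Finset.mem_image, Finset.mem_filter, Finset.mem_univ, true_and]
      constructor
      · rintro ⟨j, hj, h⟩
        rw [← σ.injective h]; simpa using hj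
      · intro h
        exact ⟨π k, h, by simp⟩
    rw [if_pos]
    · congr 2
      refine Finset.card_bij (fun k _ => σ k) ?_ (fun _ _ _ _ h => σ.injective h) ?_
      · intro k hk
        simp only [Finset.mem_filter, Finset.mem_univ, true_and] at hk
        rw [Finset.mem_sdiff, himg, not_lt]
        simpa using hk
      · intro c hc
        refine ⟨σ.symm c, ?_, by simp⟩
        rw [Finset.mem_sdiff, ← σ.apply_symm_apply c, himg, not_lt] at hc
        simpa using hc
    · have : φ σ (π i) = σ i := by simp [hφ]
      rw [this, Finset.mem_sdiff, himg]
      simpa using hσ' i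
  rw [Finset.sum_congr rfl hterm, ← Finset.sum_image (f := w) (hφinj.injOn)]
  exact Finset.sum_le_sum_of_subset_of_nonneg (Finset.subset_univ _) fun f _ _ =>
    Finset.prod_nonneg fun j _ => by split_ifs <;> positivity

/-- If every system of distinct representatives of `S` has average greedy probability at least
`c`, then there are at most `c⁻¹` of them. -/
theorem card_transversals_mul_le_one {n : ℕ} (S : Fin n → Finset (Fin n)) (c : ℝ)
    (h : ∀ σ : Equiv.Perm (Fin n), (∀ i, σ i ∈ S i) → (n.factorial : ℝ) * c ≤
      ∑ π : Equiv.Perm (Fin n),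
        ∏ i, (laterCount (Finset.univ.filter fun k => σ k ∈ S i) i π : ℝ)⁻¹) :
    ((Finset.univ.filter fun σ : Equiv.Perm (Fin n) => ∀ i, σ i ∈ S i).card : ℝ) * c ≤ 1 := by
  set M := Finset.univ.filter fun σ : Equiv.Perm (Fin n) => ∀ i, σ i ∈ S i with hM
  have h1 : (M.card : ℝ) * (n.factorial * c) ≤ n.factorial := by
    calc (M.card : ℝ) * (n.factorial * c) = ∑ σ ∈ M, n.factorial * c := by simp
      _ ≤ ∑ σ ∈ M, ∑ π : Equiv.Perm (Fin n),
          ∏ i, (laterCount (Finset.univ.filter fun k => σ k ∈ S i) i π : ℝ)⁻¹ :=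
        Finset.sum_le_sum fun σ hσ => h σ (by simpa [hM] using hσ)
      _ ≤ ∑ π : Equiv.Perm (Fin n), 1 := by
        rw [Finset.sum_comm]
        exact Finset.sum_le_sum fun π _ => sum_prod_inv_laterCount_le_one S π
      _ = n.factorial := by simp [Fintype.card_perm]
  have hn : (0 : ℝ) < n.factorial := by positivity
  nlinarith

theorem permanent_eq_card_s13 {n : ℕ} (B : Matrix (Fin n) (Fin n) ℕ)
    (hB : ∀ i j, B i j = 0 ∨ B i j = 1) :
    permanent B = (Finset.univ.filter fun σ : Equiv.Perm (Fin n) =>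
      ∀ i, σ i ∈ Finset.univ.filter fun j => B i j = 1).card := by
  unfold permanent
  rw [Finset.card_filter]
  refine Finset.sum_congr rfl fun σ _ => ?_
  simp only [Finset.mem_filter, Finset.mem_univ, true_and]
  split_ifs with h
  · exact Finset.prod_eq_one fun i _ => h i
  · push Not at h
    obtain ⟨i, hi⟩ := h
    exact Finset.prod_eq_zero (Finset.mem_univ i) ((hB i _).resolve_right hi)

theorem confMatrix_eq_one_iff {n d : ℕ} {x : Fin n → ℕ} {i j : Fin n} :
    confMatrix n d x i j = 1 ↔ x i ≤ (j : ℕ) + 1 ∧ (j : ℕ) + 1 ≤ x i + d - 1 := by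
  unfold confMatrix
  split_ifs with h
  · exact ⟨fun _ => h, fun _ => rfl⟩
  · exact ⟨fun h0 => absurd h0 (by simp), fun h1 => absurd h1 h⟩

theorem card_row_confMatrix {n d : ℕ} (hdn : d ≤ n) {x : Fin n → ℕ}
    (hx : ValidConf n d x) (i : Fin n) :
    (Finset.univ.filter fun j => confMatrix n d x i j = 1).card = d := by
  obtain ⟨h1, h2⟩ := hx i
  have : (Finset.univ.filter fun j => confMatrix n d x i j = 1).map Fin.valEmbedding =
      Finset.Ico (x i - 1) (x i - 1 + d) := by
    ext k
    simp only [Finset.mem_map, Finset.mem_filter, Finset.mem_univ, true_and,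
      confMatrix_eq_one_iff, Fin.valEmbedding_apply, Finset.mem_Ico]
    constructor
    · rintro ⟨j, hj, rfl⟩
      omega
    · intro hk
      exact ⟨⟨k, by omega⟩, by simp only; omega, rfl⟩
  rw [← Finset.card_map Fin.valEmbedding, this]
  simp

/-- A matrix of contiguous rows without a constant block has permanent smaller than the Bregman
bound by an exponential factor. -/
theorem permanent_le_exp_of_not_containsAllOnes {n d : ℕ} (hd : 0 < d) (hdn : d ≤ n)
    (B : Matrix (Fin n) (Fin n) ℕ) (hB : IsGamma n d B) (hdiag : ∀ i, B i i = 1)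
    (hno : ¬ ContainsAllOnes d B) :
    (permanent B : ℝ) ≤ Real.exp (n * (Real.log d.factorial / d) -
      (n / (16 * d) : ℕ) *
        (Real.log (1 + 1 / (4 * ((d * d : ℕ) : ℝ) ^ 2)) / 2 / (8 * d).factorial)) := by
  obtain ⟨x, hx, rfl⟩ := hB
  set S : Fin n → Finset (Fin n) :=
    fun i => Finset.univ.filter fun j => confMatrix n d x i j = 1 with hS
  have hmemS : ∀ i j, j ∈ S i ↔ x i ≤ (j : ℕ) + 1 ∧ (j : ℕ) + 1 ≤ x i + d - 1 := by
    intro i j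
    simp [hS, confMatrix_eq_one_iff]
  have hx' : ∀ i : Fin n, x i ≤ (i : ℕ) + 1 ∧ (i : ℕ) + 1 ≤ x i + d - 1 := fun i =>
    confMatrix_eq_one_iff.mp (hdiag i)
  rw [permanent_eq_card_s13 _ (fun i j => by unfold confMatrix; split_ifs <;> simp)]
  set E : ℝ := -(n * (Real.log d.factorial / d)) + (n / (16 * d) : ℕ) *
    (Real.log (1 + 1 / (4 * ((d * d : ℕ) : ℝ) ^ 2)) / 2 / (8 * d).factorial) with hE
  have key := card_transversals_mul_le_one S (Real.exp E) ?_
  · rw [← le_div_iff₀ (Real.exp_pos _), one_div, ← Real.exp_neg] at key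
    refine key.trans (Real.exp_le_exp.mpr ?_)
    rw [hE]; linarith
  intro σ hσ
  set K : Fin n → Finset (Fin n) := fun i => Finset.univ.filter fun k => σ k ∈ S i with hK
  have hmemK : ∀ i k, k ∈ K i ↔ σ k ∈ S i := by intro i k; simp [hK]
  have hcardK : ∀ i, (K i).card = d := by
    intro i
    rw [← card_row_confMatrix hdn hx i]
    refine Finset.card_bij (fun k _ => σ k) (fun k hk => (hmemK i k).mp hk)
      (fun _ _ _ _ h => σ.injective h) fun j hj => ⟨σ.symm j, ?_, by simp⟩
    rw [hmemK, Equiv.apply_symm_apply]; exact hj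
  have hnear : ∀ i k, k ∈ K i → (k : ℕ) < i + 2 * d ∧ (i : ℕ) < k + 2 * d := by
    intro i k hk
    have h1 := (hmemS _ _).mp ((hmemK i k).mp hk)
    have h2 := (hmemS _ _).mp (hσ k)
    have h3 := hx' i
    have h4 := hx' k
    omega
  have hex : ∀ i, ∃ k ∈ K i, K i ≠ K k := by
    intro i
    by_contra! hall
    refine hno ⟨K i, S i, hcardK i, card_row_confMatrix hdn hx i, fun k hk j hj => ?_⟩
    have h1 : σ.symm j ∈ K i := by rw [hmemK, Equiv.apply_symm_apply]; exact hj
    rw [hall k hk, hmemK, Equiv.apply_symm_apply] at h1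
    simpa [hS] using h1
  choose q hq hne using hex
  have hidx : ∀ w : Fin (n / (16 * d)), 16 * d * (w : ℕ) < n := by
    intro w
    have h1 : 16 * d * ((w : ℕ) + 1) ≤ 16 * d * (n / (16 * d)) := Nat.mul_le_mul_left _ w.2
    have h2 := Nat.mul_div_le n (16 * d)
    rw [mul_add] at h1
    omega
  set p : Fin (n / (16 * d)) → Fin n := fun w => ⟨16 * d * w, hidx w⟩ with hp
  set V : Fin (n / (16 * d)) → Finset (Fin n) := fun w =>
    Finset.univ.filter fun r => (r : ℕ) < p w + 4 * d ∧ (p w : ℕ) < r + 4 * d with hV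
  have hmemV : ∀ w r, r ∈ V w ↔ (r : ℕ) < p w + 4 * d ∧ (p w : ℕ) < r + 4 * d := by
    intro w r; simp [hV]
  refine factorial_mul_exp_le_sum_prod_inv_laterCount hd K (fun i => (hmemK i i).mpr (hσ i))
    hcardK p (fun w => q (p w)) V (fun w => hq _) (fun w => hne _) ?_ ?_ ?_ ?_ ?_
  · intro w w' hww
    rw [Finset.disjoint_left]
    intro r h1 h2
    rw [hmemV] at h1 h2
    simp only [hp] at h1 h2
    rcases lt_or_gt_of_ne (Fin.val_ne_of_ne hww) with h | h
    · have h3 : 16 * d * ((w : ℕ) + 1) ≤ 16 * d * w' := Nat.mul_le_mul_left _ h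
      rw [mul_add] at h3
      omega
    · have h3 : 16 * d * ((w' : ℕ) + 1) ≤ 16 * d * w := Nat.mul_le_mul_left _ h
      rw [mul_add] at h3
      omega
  · intro w r hr
    rw [hmemV] at hr
    have h1 := hnear _ _ (hq (p w))
    refine ⟨fun h => ?_, fun h => ?_⟩ <;> have h2 := hnear _ _ h <;> omega
  · intro w r hr
    have h1 := hnear _ _ hr
    rw [hmemV]; omega
  · intro w r hr
    have h1 := hnear _ _ hr
    have h2 := hnear _ _ (hq (p w))
    rw [hmemV]; omega
  · intro w
    calc (V w).card ≤ (Finset.Ico ((p w : ℕ) + 1 - 4 * d) (p w + 4 * d)).card := by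
          refine Finset.card_le_card_of_injOn (fun r => (r : ℕ)) (fun r hr => ?_)
            Fin.val_injective.injOn
          have := (hmemV w r).mp hr
          simp only [Finset.coe_Ico, Set.mem_Ico]
          omega
      _ ≤ 8 * d := by rw [Nat.card_Ico]; omega

theorem factorial_pow_le_permanent_directSumOnes {a d t : ℕ} (A : Matrix (Fin a) (Fin a) ℕ)
    (hdiag : ∀ i, A i i = 1) : d.factorial ^ t ≤ permanent (directSumOnes a d t A) := by
  let e : Fin a ⊕ (Fin t × Fin d) ≃ Fin (a + t * d) :=
    (Equiv.sumCongr (Equiv.refl _) finProdFinEquiv).trans finSumFinEquiv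
  let φ : (Fin t → Equiv.Perm (Fin d)) → Equiv.Perm (Fin (a + t * d)) := fun g =>
    e.permCongr (Equiv.sumCongr (Equiv.refl _) (Equiv.prodShear (Equiv.refl _) g))
  have hφl : ∀ g i, φ g (e (Sum.inl i)) = e (Sum.inl i) := by
    intro g i; simp [φ, Equiv.permCongr_apply]
  have hφr : ∀ g k l, φ g (e (Sum.inr (k, l))) = e (Sum.inr (k, g k l)) := by
    intro g k l; simp [φ, Equiv.permCongr_apply]
  have hφ : φ.Injective := by
    intro g h hgh
    ext k l
    have := congrArg (fun τ => e.symm (τ (e (Sum.inr (k, l))))) hgh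
    simp only [hφr, Equiv.symm_apply_apply, Sum.inr.injEq, Prod.mk.injEq, true_and] at this
    rw [this]
  have hone : ∀ g, ∏ i, directSumOnes a d t A i (φ g i) = 1 := by
    intro g
    refine Finset.prod_eq_one fun i _ => ?_
    obtain ⟨y, rfl⟩ := e.surjective i
    rcases y with i | ⟨k, l⟩
    · rw [hφl]
      have : (e (Sum.inl i) : ℕ) = i := by simp [e]
      simp [directSumOnes, this, hdiag]
    · rw [hφr]
      have hval : ∀ l : Fin d, (e (Sum.inr (k, l)) : ℕ) = a + (l + d * k) := by
        intro l; simp [e]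
      have hdiv : ∀ l : Fin d, ((l : ℕ) + d * k) / d = k := by
        intro l
        rw [Nat.add_mul_div_left _ _ (Nat.zero_lt_of_lt l.2), Nat.div_eq_of_lt l.2, zero_add]
      simp [directSumOnes, hval, hdiv]
  calc d.factorial ^ t = ∑ g : Fin t → Equiv.Perm (Fin d), 1 := by
        simp [Fintype.card_perm]
    _ = ∑ g : Fin t → Equiv.Perm (Fin d), ∏ i, directSumOnes a d t A i (φ g i) :=
        Finset.sum_congr rfl fun g _ => (hone g).symm
    _ = ∑ σ ∈ Finset.univ.image φ, ∏ i, directSumOnes a d t A i (σ i) :=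
        (Finset.sum_image (f := fun σ : Equiv.Perm (Fin (a + t * d)) =>
          ∏ i, directSumOnes a d t A i (σ i)) hφ.injOn).symm
    _ ≤ permanent (directSumOnes a d t A) :=
        Finset.sum_le_sum_of_subset (Finset.subset_univ _)

/-- For every `A ∈ Γ_a^d` (containing the identity) there exists `m(A)` such that
`per(A ⊕ t·1_{d×d}) > per(B)` for every positive integer `t` with `a + td > m(A)` and
every `B ∈ Γ_{a+td}^d` (containing the identity) that does not contain `1_{d×d}` as a
sub-matrix. -/
theorem direct_sum_beats_no_block (d a : ℕ) (hd : 1 ≤ d) (hda : d ≤ a)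
    (A : Matrix (Fin a) (Fin a) ℕ) (hA : IsGamma a d A) (hdiagA : ∀ i, A i i = 1) :
    ∃ m : ℕ, ∀ t : ℕ, 0 < t → m < a + t * d →
      ∀ B : Matrix (Fin (a + t * d)) (Fin (a + t * d)) ℕ,
        IsGamma (a + t * d) d B → (∀ i, B i i = 1) → ¬ ContainsAllOnes d B →
        permanent B < permanent (directSumOnes a d t A) := by
  have hd' : (0 : ℝ) < d := by exact_mod_cast hd
  set ε : ℝ := Real.log (1 + 1 / (4 * ((d * d : ℕ) : ℝ) ^ 2)) / 2 / (8 * d).factorial with hε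
  have hε0 : 0 < ε := by
    have : 0 < Real.log (1 + 1 / (4 * ((d * d : ℕ) : ℝ) ^ 2)) :=
      Real.log_pos (lt_add_of_pos_right _ (by push_cast; positivity))
    positivity
  obtain ⟨N, hN⟩ := exists_nat_gt (a * (Real.log d.factorial / d) / ε)
  rw [div_lt_iff₀ hε0] at hN
  refine ⟨16 * d * N, fun t _ ht B hB hdiag hno => ?_⟩
  refine lt_of_lt_of_le ?_ (factorial_pow_le_permanent_directSumOnes A hdiagA)
  have hle := permanent_le_exp_of_not_containsAllOnes hd (by omega) B hB hdiag hno
  rw [← hε] at hle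
  have hfac : (0 : ℝ) < d.factorial := by positivity
  have hpow : ((d.factorial ^ t : ℕ) : ℝ) = Real.exp (t * Real.log d.factorial) := by
    rw [Real.exp_nat_mul, Real.exp_log hfac]; push_cast; rfl
  have hNle : (N : ℝ) ≤ ((a + t * d) / (16 * d) : ℕ) := by
    have : N ≤ (a + t * d) / (16 * d) := by
      rw [Nat.le_div_iff_mul_le (by omega), mul_comm]
      exact ht.le
    exact_mod_cast this
  have hlt : (permanent B : ℝ) < ((d.factorial ^ t : ℕ) : ℝ) := by
    rw [hpow]
    refine hle.trans_lt (Real.exp_lt_exp.mpr ?_)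
    have h1 : ((a + t * d : ℕ) : ℝ) * (Real.log d.factorial / d) =
        a * (Real.log d.factorial / d) + t * Real.log d.factorial := by
      push_cast; field_simp
    rw [h1]
    have := mul_le_mul_of_nonneg_right hNle hε0.le
    linarith
  exact_mod_cast hlt
end

section
/- For each positive integer d there exists an integer μ_d such that for all n ≥ μ_d and all A ∈ Γ_n^d: A ∈ M_n^d if and only if A ⊕ 1_{d×d} ∈ M_{n+d}^d. -/
/-- `A ∈ M_n^d`: `A ∈ Γ_n^d` and `A` attains the maximum permanent over `Γ_n^d`. -/
def MaxPerm (n d : ℕ) (A : Matrix (Fin n) (Fin n) ℕ) : Prop :=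
  IsGamma n d A ∧
    ∀ B : Matrix (Fin n) (Fin n) ℕ, IsGamma n d B → permanent B ≤ permanent A

/-- The block-diagonal direct sum `A ⊕ 1_{d×d}` of an `n × n` matrix `A` with the
all-ones `d × d` matrix. -/
def addOnesBlock (n d : ℕ) (A : Matrix (Fin n) (Fin n) ℕ) :
    Matrix (Fin (n + d)) (Fin (n + d)) ℕ :=
  fun i j =>
    if hi : (i : ℕ) < n then
      if hj : (j : ℕ) < n then A ⟨i, hi⟩ ⟨j, hj⟩ else 0
    else
      if (j : ℕ) < n then 0 else 1

open Finset in
/-- Gibbs bound for the entropy of one coordinate. -/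
theorem card_mul_log_card_le {α β : Type*} [DecidableEq β] [Fintype β] (S : Finset α) (f : α → β)
    (q : β → ℝ) (hq : ∀ b, 0 ≤ q b) (hpos : ∀ a ∈ S, 0 < q (f a)) (hsum : ∑ b, q b ≤ 1) :
    (#S : ℝ) * Real.log #S ≤ ∑ a ∈ S, (Real.log #{a' ∈ S | f a' = f a} - Real.log (q (f a))) := by
  rcases S.eq_empty_or_nonempty with rfl | hS
  · simp
  have hN : (0 : ℝ) < #S := by exact_mod_cast hS.card_pos
  have hfib : ∀ a ∈ S, (0 : ℝ) < #{a' ∈ S | f a' = f a} := fun a ha => by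
    exact_mod_cast card_pos.2 ⟨a, by simp [ha]⟩
  have hterm : ∀ a ∈ S, Real.log #S - (Real.log #{a' ∈ S | f a' = f a} - Real.log (q (f a))) ≤
      #S * (q (f a) / #{a' ∈ S | f a' = f a}) - 1 := by
    intro a ha
    have h1 := hfib a ha
    have h2 := hpos a ha
    have h := Real.log_le_sub_one_of_pos
      (show 0 < #S * (q (f a) / #{a' ∈ S | f a' = f a}) by positivity)
    rw [Real.log_mul hN.ne' (by positivity), Real.log_div h2.ne' h1.ne'] at h
    linarith
  have hbound : ∑ a ∈ S, q (f a) / #{a' ∈ S | f a' = f a} ≤ 1 := by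
    rw [sum_comp (fun b => q b / (#{a' ∈ S | f a' = b} : ℝ)) f]
    refine le_trans ?_ (le_trans (sum_le_univ_sum_of_nonneg (s := S.image f) hq) hsum)
    refine sum_le_sum fun b hb => ?_
    obtain ⟨a, ha, rfl⟩ := mem_image.1 hb
    have := hfib a ha
    rw [nsmul_eq_mul]
    field_simp
    rfl
  have h := sum_le_sum hterm
  rw [sum_sub_distrib, sum_sub_distrib, sum_sub_distrib, ← mul_sum] at h
  rw [sum_sub_distrib]
  simp only [sum_const, nsmul_eq_mul, mul_one] at h
  nlinarith

open Finset in
/-- Averaging the chain rule for entropy over the row that is revealed first: a potential `F`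
that dominates the expected cost of every step bounds the logarithm of the number of
permutations in `S`. -/
theorem log_card_le_of_step {α : Type*} [Fintype α] [DecidableEq α]
    (S : Finset (Equiv.Perm α)) (F : Finset α → Finset α → ℝ)
    (q : Finset α → Finset α → α → α → ℝ)
    (hF : 0 ≤ F univ univ)
    (hq : ∀ T C, (∃ σ ∈ S, T.image σ = C) → ∀ i, ∀ k, 0 ≤ q T C i k)
    (hpos : ∀ T, ∀ σ ∈ S, ∀ i ∉ T, 0 < q T (T.image σ) i (σ i))
    (hsum : ∀ T C, (∃ σ ∈ S, T.image σ = C) → ∀ i ∉ T, ∑ k, q T C i k ≤ 1)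
    (hstep : ∀ T, ∀ σ ∈ S,
      ∑ i ∈ Tᶜ, (F (insert i T) (insert (σ i) (T.image σ)) -
        Real.log (q T (T.image σ) i (σ i))) ≤ #Tᶜ * F T (T.image σ))
    (hS : S.Nonempty) : Real.log #S ≤ F ∅ ∅ := by
  suffices H : ∀ m : ℕ, ∀ T : Finset α, #Tᶜ = m → ∀ S' ⊆ S, S'.Nonempty → ∀ C : Finset α,
      (∀ σ ∈ S', T.image σ = C) → (∀ σ ∈ S', ∀ τ ∈ S', ∀ i ∈ T, σ i = τ i) →
      Real.log #S' ≤ F T C from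
    H _ ∅ rfl S subset_rfl hS ∅ (by simp) (by simp)
  intro m
  induction m with
  | zero =>
    intro T hT S' hS' hne C hC hag
    have hTu : T = univ := by simpa using hT
    subst hTu
    obtain ⟨σ, hσ⟩ := hne
    have hone : S' = {σ} := by
      ext τ
      simp only [mem_singleton]
      exact ⟨fun h => Equiv.ext fun i => hag τ h σ hσ i (mem_univ i), fun h => h ▸ hσ⟩
    have hCu : C = univ := by
      rw [← hC σ hσ]; exact image_univ_of_surjective σ.surjective
    rw [hone, hCu]; simpa using hF
  | succ m ih =>
    intro T hT S' hS' hne C hC hag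
    obtain ⟨σ₀, hσ₀⟩ := hne
    have hN : (0 : ℝ) < #S' := by exact_mod_cast card_pos.2 ⟨σ₀, hσ₀⟩
    have hrow : ∀ i ∈ Tᶜ, (#S' : ℝ) * Real.log #S' ≤
        ∑ σ ∈ S', (F (insert i T) (insert (σ i) C) - Real.log (q T C i (σ i))) := by
      intro i hi
      have hiT : i ∉ T := mem_compl.1 hi
      refine (card_mul_log_card_le S' (fun σ => σ i) (q T C i)
        (hq T C ⟨σ₀, hS' hσ₀, hC σ₀ hσ₀⟩ i)
        (fun σ hσ => by simpa [hC σ hσ] using hpos T σ (hS' hσ) i hiT)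
        (hsum T C ⟨σ₀, hS' hσ₀, hC σ₀ hσ₀⟩ i hiT)).trans ?_
      refine sum_le_sum fun σ hσ => sub_le_sub_right ?_ _
      refine ih (insert i T) ?_ _ ((filter_subset _ _).trans hS') ⟨σ, by simp [hσ]⟩ _ ?_ ?_
      · rw [compl_insert, card_erase_of_mem hi, hT]; rfl
      · intro τ hτ
        rw [mem_filter] at hτ
        rw [image_insert, hC τ hτ.1, hτ.2]
      · intro τ hτ ρ hρ j hj
        rw [mem_filter] at hτ hρ
        rcases mem_insert.1 hj with rfl | hj
        · rw [hτ.2, hρ.2]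
        · exact hag τ hτ.1 ρ hρ.1 j hj
    have h1 := sum_le_sum hrow
    rw [sum_comm] at h1
    have h2 : ∑ σ ∈ S', ∑ i ∈ Tᶜ, (F (insert i T) (insert (σ i) C) - Real.log (q T C i (σ i))) ≤
        ∑ σ ∈ S', #Tᶜ * F T C := sum_le_sum fun σ hσ => by
      have := hstep T σ (hS' hσ)
      rwa [hC σ hσ] at this
    have h3 := h1.trans h2
    simp only [sum_const, nsmul_eq_mul, hT] at h3
    have hm : (0 : ℝ) < ((m + 1 : ℕ) : ℝ) := by positivity
    have h4 : ((m + 1 : ℕ) : ℝ) * #S' * Real.log #S' ≤ ((m + 1 : ℕ) : ℝ) * #S' * F T C := by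
      linarith
    exact le_of_mul_le_mul_left h4 (by positivity)

/-- Logarithm of Brègman's row factor `(m!)^(1/m)`. -/
noncomputable def bregmanLog (m : ℕ) : ℝ := Real.log (m.factorial) / m

/-- The amount by which the expected number of hits of column `l` differs from one, when each
remaining row `j ∉ T` picks uniformly among its free columns `I j \ C`. -/
noncomputable def columnDefect {α : Type*} [Fintype α] [DecidableEq α] (I : α → Finset α)
    (T C : Finset α) (l : α) : ℝ :=
  1 - ∑ j ∈ Tᶜ with l ∈ I j, (1 / (I j \ C).card : ℝ)

/-- The perturbation of the uniform choice in row `j` towards columns of positive defect. -/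
noncomputable def defectTilt {α : Type*} [Fintype α] [DecidableEq α] (I : α → Finset α)
    (ε : ℝ) (T C : Finset α) (j l : α) : ℝ :=
  ε * (columnDefect I T C l - (∑ k ∈ I j \ C, columnDefect I T C k) / (I j \ C).card)

/-- The tilted distribution on the free columns of row `j`. -/
noncomputable def tiltedKernel {α : Type*} [Fintype α] [DecidableEq α] (I : α → Finset α)
    (ε : ℝ) (T C : Finset α) (j l : α) : ℝ :=
  if l ∈ I j \ C then (1 + defectTilt I ε T C j l) / (I j \ C).card else 0

theorem mul_bregmanLog (m : ℕ) : m * bregmanLog m = Real.log m.factorial := by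
  rcases Nat.eq_zero_or_pos m with rfl | hm
  · simp
  · rw [bregmanLog]; field_simp

section
open Finset

theorem apply_mem_sdiff_image {α : Type*} [DecidableEq α] {I : α → Finset α} {σ : Equiv.Perm α}
    (hσ : ∀ i, σ i ∈ I i) {T : Finset α} {i : α} (hi : i ∉ T) :
    σ i ∈ I i \ T.image σ := by
  simp [hσ i, hi]

variable {α : Type*} [Fintype α] [DecidableEq α] {I : α → Finset α} {σ : Equiv.Perm α}

theorem sum_compl_apply (T : Finset α) (f : α → ℝ) :
    ∑ i ∈ Tᶜ, f (σ i) = ∑ l ∈ (T.image σ)ᶜ, f l := by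
  refine sum_bij (fun i _ => σ i) ?_ (fun _ _ _ _ h => σ.injective h) ?_ (fun _ _ => rfl)
  · simp
  · intro b hb
    refine ⟨σ.symm b, ?_, by simp⟩
    simp only [mem_compl, mem_image, not_exists, not_and] at hb ⊢
    exact fun h => hb _ h (by simp)

/-- The exact averaging identity behind Brègman's inequality. -/
theorem sum_bregmanLog_insert (hσ : ∀ i, σ i ∈ I i) (T : Finset α) :
    ∑ i ∈ Tᶜ, (∑ j ∈ (insert i T)ᶜ, bregmanLog #(I j \ insert (σ i) (T.image σ)) +
      Real.log #(I i \ T.image σ)) =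
    #Tᶜ * ∑ j ∈ Tᶜ, bregmanLog #(I j \ T.image σ) := by
  have hcol : ∀ j ∈ Tᶜ, ∑ i ∈ Tᶜ.erase j, bregmanLog #(I j \ insert (σ i) (T.image σ)) +
      Real.log #(I j \ T.image σ) = #Tᶜ * bregmanLog #(I j \ T.image σ) := by
    intro j hj
    have hjT : j ∉ T := mem_compl.1 hj
    have hmem := apply_mem_sdiff_image hσ hjT
    set V := I j \ T.image σ with hV
    obtain ⟨m, hm⟩ : ∃ m, #V = m + 1 := Nat.exists_eq_succ_of_ne_zero (card_ne_zero_of_mem hmem)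
    have h1 : ∑ i ∈ Tᶜ, (if σ i ∈ V then bregmanLog m else bregmanLog (m + 1)) =
        (m + 1) * bregmanLog m + (#Tᶜ - (m + 1)) * bregmanLog (m + 1) := by
      rw [sum_compl_apply T (fun l => if l ∈ V then bregmanLog m else bregmanLog (m + 1))]
      rw [sum_ite]
      simp only [sum_const, nsmul_eq_mul]
      have hsub : V ⊆ (T.image σ)ᶜ := by
        intro l hl; simp only [hV, mem_sdiff] at hl; exact mem_compl.2 hl.2
      have e1 : ({l ∈ (T.image σ)ᶜ | l ∈ V}) = V := by
        ext l; simp only [mem_filter]; exact ⟨fun h => h.2, fun h => ⟨hsub h, h⟩⟩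
      have e2 : ({l ∈ (T.image σ)ᶜ | l ∉ V}) = (T.image σ)ᶜ \ V := by
        ext l; simp
      have e3 : #Tᶜ = #(T.image σ)ᶜ := by
        rw [card_compl, card_compl, card_image_of_injective _ σ.injective]
      rw [e1, e2, card_sdiff_of_subset hsub, Nat.cast_sub (card_le_card hsub), hm, e3]
      push_cast; ring
    have h2 : ∀ i ∈ Tᶜ, bregmanLog #(I j \ insert (σ i) (T.image σ)) =
        if σ i ∈ V then bregmanLog m else bregmanLog (m + 1) := by
      intro i _
      have e : I j \ insert (σ i) (T.image σ) = V.erase (σ i) := by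
        ext l; simp only [hV, mem_sdiff, mem_insert, mem_erase]; tauto
      rw [e]
      split_ifs with h
      · rw [card_erase_of_mem h, hm]; rfl
      · rw [erase_eq_of_notMem h, hm]
    have h3 : ∑ i ∈ Tᶜ.erase j, bregmanLog #(I j \ insert (σ i) (T.image σ)) + bregmanLog m =
        (m + 1) * bregmanLog m + (#Tᶜ - (m + 1)) * bregmanLog (m + 1) := by
      rw [← h1, ← sum_erase_add _ _ hj, if_pos hmem]
      congr 1
      exact sum_congr rfl fun i hi => h2 i (mem_of_mem_erase hi)
    have h4 := mul_bregmanLog m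
    have h5 := mul_bregmanLog (m + 1)
    rw [Nat.factorial_succ, Nat.cast_mul, Real.log_mul (by positivity) (by positivity)] at h5
    rw [hm]
    push_cast at h5 ⊢
    linarith
  rw [mul_sum, ← sum_congr rfl hcol, sum_add_distrib, sum_add_distrib]
  congr 1
  rw [sum_comm' (t' := Tᶜ) (s' := fun j => Tᶜ.erase j)]
  intro i j
  simp only [mem_compl, mem_insert, mem_erase, not_or]
  tauto

theorem abs_columnDefect_le {K : ℝ} (hσ : ∀ i, σ i ∈ I i)
    (hK : ∀ l, (#{j | l ∈ I j} : ℝ) ≤ K) (T : Finset α) (l : α) :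
    |columnDefect I T (T.image σ) l| ≤ K + 1 ∧
      ∑ j ∈ Tᶜ with l ∈ I j, (1 / #(I j \ T.image σ) : ℝ) ≤ K := by
  have h0 : 0 ≤ ∑ j ∈ Tᶜ with l ∈ I j, (1 / #(I j \ T.image σ) : ℝ) :=
    sum_nonneg fun j _ => by positivity
  have h1 : ∑ j ∈ Tᶜ with l ∈ I j, (1 / #(I j \ T.image σ) : ℝ) ≤ K := by
    refine le_trans (sum_le_card_nsmul _ _ 1 fun j hj => ?_) ?_
    · have hj' : j ∉ T := mem_compl.1 (mem_filter.1 hj).1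
      have : (1 : ℝ) ≤ #(I j \ T.image σ) := by
        exact_mod_cast card_pos.2 ⟨_, apply_mem_sdiff_image hσ hj'⟩
      rw [div_le_one (by linarith)]; exact this
    · rw [nsmul_eq_mul, mul_one]
      refine le_trans ?_ (hK l)
      exact_mod_cast card_le_card fun j hj => by simpa using (mem_filter.1 hj).2
  refine ⟨?_, h1⟩
  rw [columnDefect, abs_le]
  constructor <;> linarith

theorem abs_defectTilt_le {K ε : ℝ} (hε : 0 ≤ ε) (hσ : ∀ i, σ i ∈ I i)
    (hK : ∀ l, (#{j | l ∈ I j} : ℝ) ≤ K) (T : Finset α) (hK0 : 0 ≤ K) (j l : α) :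
    |defectTilt I ε T (T.image σ) j l| ≤ ε * (2 * (K + 1)) := by
  rw [defectTilt, abs_mul, abs_of_nonneg hε]
  refine mul_le_mul_of_nonneg_left ?_ hε
  refine (abs_sub _ _).trans ?_
  have h1 := (abs_columnDefect_le hσ hK T l).1
  have h2 : |(∑ k ∈ I j \ T.image σ, columnDefect I T (T.image σ) k) / #(I j \ T.image σ)| ≤
      K + 1 := by
    rw [abs_div, Nat.abs_cast]
    refine div_le_of_le_mul₀ (by positivity) (by positivity) ?_
    refine (abs_sum_le_sum_abs _ _).trans ?_
    refine (sum_le_card_nsmul _ _ (K + 1) fun k _ => (abs_columnDefect_le hσ hK T k).1).trans ?_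
    rw [nsmul_eq_mul, mul_comm]
  linarith

theorem sub_two_mul_sq_le_log {t : ℝ} (ht : |t| ≤ 1 / 2) : t - 2 * t ^ 2 ≤ Real.log (1 + t) := by
  rw [abs_le] at ht
  have hpos : 0 < 1 + t := by linarith [ht.1]
  refine le_trans ?_ (Real.one_sub_inv_le_log_of_pos hpos)
  rw [← sub_nonneg]
  have : 1 - (1 + t)⁻¹ - (t - 2 * t ^ 2) = t ^ 2 * (1 + 2 * t) / (1 + t) := by
    field_simp; ring
  rw [this]
  have : 0 ≤ 1 + 2 * t := by linarith [ht.1]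
  positivity

theorem sum_avg_eq (T : Finset α) (C : Finset α) (f : α → ℝ) :
    ∑ i ∈ Tᶜ, (∑ l ∈ I i \ C, f l) / #(I i \ C) =
      ∑ l ∈ Cᶜ, f l * (1 - columnDefect I T C l) := by
  have h : ∀ i ∈ Tᶜ, (∑ l ∈ I i \ C, f l) / #(I i \ C) =
      ∑ l ∈ I i \ C, f l * (1 / #(I i \ C)) := fun i _ => by
    rw [← sum_mul]; ring
  rw [sum_congr rfl h]
  simp only [columnDefect, sub_sub_cancel, mul_sum]
  refine sum_comm' fun i l => ?_
  simp only [mem_compl, mem_sdiff, mem_filter]; tauto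

/-- The tilted distributions beat the uniform ones by a multiple of the sum of squared defects. -/
theorem sum_log_defectTilt_ge {K ε : ℝ} (hK0 : 0 ≤ K) (hε : ε = 1 / (8 * (K + 1)))
    (hσ : ∀ i, σ i ∈ I i) (hK : ∀ l, (#{j | l ∈ I j} : ℝ) ≤ K) (T : Finset α) :
    ε / 2 * ∑ l ∈ (T.image σ)ᶜ, columnDefect I T (T.image σ) l ^ 2 ≤
      ∑ i ∈ Tᶜ, Real.log (1 + defectTilt I ε T (T.image σ) i (σ i)) := by
  have hε0 : 0 < ε := by rw [hε]; positivity
  have hεK : ε * (K + 1) = 1 / 8 := by rw [hε]; field_simp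
  set C := T.image σ with hC
  set D := columnDefect I T C with hD
  have hlog : ∀ i ∈ Tᶜ, defectTilt I ε T C i (σ i) - 4 * ε ^ 2 * (D (σ i) ^ 2 +
      (∑ l ∈ I i \ C, D l ^ 2) / #(I i \ C)) ≤ Real.log (1 + defectTilt I ε T C i (σ i)) := by
    intro i hi
    have ht := abs_defectTilt_le hε0.le hσ hK T hK0 i (σ i)
    refine le_trans ?_ (sub_two_mul_sq_le_log (ht.trans (by nlinarith)))
    have hr : (0 : ℝ) < #(I i \ C) := by
      exact_mod_cast card_pos.2 ⟨_, apply_mem_sdiff_image hσ (mem_compl.1 hi)⟩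
    have hcs : ((∑ l ∈ I i \ C, D l) / #(I i \ C)) ^ 2 ≤
        (∑ l ∈ I i \ C, D l ^ 2) / #(I i \ C) := by
      rw [div_pow, div_le_div_iff₀ (by positivity) hr]
      have := sq_sum_le_card_mul_sum_sq (s := I i \ C) (f := D)
      nlinarith
    have : defectTilt I ε T C i (σ i) ^ 2 ≤ 2 * ε ^ 2 * (D (σ i) ^ 2 +
      (∑ l ∈ I i \ C, D l ^ 2) / #(I i \ C)) := by
      rw [defectTilt, mul_pow, ← hD]
      have h2 := sq_nonneg (D (σ i) + (∑ l ∈ I i \ C, D l) / #(I i \ C))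
      have h3 : (D (σ i) - (∑ l ∈ I i \ C, D l) / #(I i \ C)) ^ 2 ≤ 2 * (D (σ i) ^ 2 +
        (∑ l ∈ I i \ C, D l ^ 2) / #(I i \ C)) := by nlinarith
      have := mul_le_mul_of_nonneg_left h3 (sq_nonneg ε)
      linarith
    linarith
  refine le_trans ?_ (sum_le_sum hlog)
  rw [sum_sub_distrib, ← mul_sum, sum_add_distrib, sum_avg_eq, sum_compl_apply T (fun l => D l ^ 2)]
  simp only [defectTilt]
  rw [← mul_sum, sum_sub_distrib, sum_avg_eq, sum_compl_apply T (fun l => columnDefect I T C l),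
    ← hC, ← hD, ← sum_sub_distrib, ← sum_add_distrib, mul_sum, mul_sum, mul_sum, ← sum_sub_distrib]
  refine sum_le_sum fun l _ => ?_
  have hw : 1 - D l ≤ K := by
    have := (abs_columnDefect_le hσ hK T l).2
    rw [hD, columnDefect]; linarith
  have h1 : ε * (D l ^ 2 * (1 + (1 - D l))) ≤ ε * (D l ^ 2 * (K + 1)) := by
    refine mul_le_mul_of_nonneg_left (mul_le_mul_of_nonneg_left ?_ (sq_nonneg _)) hε0.le
    linarith
  have h2 : ε * (D l ^ 2 * (K + 1)) = D l ^ 2 / 8 := by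
    linear_combination (D l ^ 2) * hεK
  have h3 := mul_le_mul_of_nonneg_left (h1.trans h2.le) hε0.le
  nlinarith

theorem tiltedKernel_nonneg {K ε : ℝ} (hK0 : 0 ≤ K) (hε : ε = 1 / (8 * (K + 1)))
    (hσ : ∀ i, σ i ∈ I i) (hK : ∀ l, (#{j | l ∈ I j} : ℝ) ≤ K) (T : Finset α) (i k : α) :
    0 < 1 + defectTilt I ε T (T.image σ) i k ∧ 0 ≤ tiltedKernel I ε T (T.image σ) i k := by
  have hε0 : 0 < ε := by rw [hε]; positivity
  have hεK : ε * (K + 1) = 1 / 8 := by rw [hε]; field_simp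
  have ht := abs_le.1 (abs_defectTilt_le hε0.le hσ hK T hK0 i k)
  have h : 0 < 1 + defectTilt I ε T (T.image σ) i k := by nlinarith [ht.1]
  refine ⟨h, ?_⟩
  rw [tiltedKernel]
  split_ifs
  · positivity
  · exact le_rfl

theorem sum_tiltedKernel {ε : ℝ} (hσ : ∀ i, σ i ∈ I i) {T : Finset α} {i : α} (hi : i ∉ T) :
    ∑ k, tiltedKernel I ε T (T.image σ) i k = 1 := by
  have hr : (#(I i \ T.image σ) : ℝ) ≠ 0 := by
    exact_mod_cast card_ne_zero_of_mem (apply_mem_sdiff_image hσ hi)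
  simp only [tiltedKernel, sum_ite_mem, univ_inter]
  rw [← sum_div, sum_add_distrib]
  simp only [defectTilt, ← mul_sum, sum_sub_distrib, sum_const, nsmul_eq_mul, mul_one]
  field_simp
  ring

end

/-- The columns occupied by a block of `d` consecutive ones starting in column `a i`. -/
def rowBlock {n : ℕ} (d : ℕ) (a : Fin n → ℕ) (i : Fin n) : Finset (Fin n) :=
  {c | a i ≤ c ∧ (c : ℕ) < a i + d}

/-- The columns at distance at most `2 * d` from `k`. -/
def columnWindow {n : ℕ} (d : ℕ) (k : Fin n) : Finset (Fin n) :=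
  {c | (k : ℕ) ≤ c + 2 * d ∧ (c : ℕ) ≤ k + 2 * d}

section
open Finset
variable {n d : ℕ} {a : Fin n → ℕ} {σ : Equiv.Perm (Fin n)}

theorem mem_rowBlock {i c : Fin n} : c ∈ rowBlock d a i ↔ a i ≤ c ∧ (c : ℕ) < a i + d := by
  simp [rowBlock]

theorem mem_columnWindow {k c : Fin n} :
    c ∈ columnWindow d k ↔ (k : ℕ) ≤ c + 2 * d ∧ (c : ℕ) ≤ k + 2 * d := by
  simp [columnWindow]

theorem card_columnWindow_le (k : Fin n) : #(columnWindow d k) ≤ 4 * d + 1 := by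
  have h : #(columnWindow d k) ≤ #(Icc ((k : ℕ) - 2 * d) (k + 2 * d)) := by
    refine card_le_card_of_injOn (fun j => (j : ℕ)) (fun j hj => ?_) fun j _ j' _ h => Fin.ext h
    have := mem_columnWindow.1 hj
    simp only [coe_Icc, Set.mem_Icc]
    omega
  rw [Nat.card_Icc] at h
  omega

theorem card_rowBlock {i : Fin n} (h : a i + d ≤ n) : #(rowBlock d a i) = d := by
  have e : (rowBlock d a i).map Fin.valEmbedding = Ico (a i) (a i + d) := by
    ext c
    simp only [mem_map, mem_rowBlock, Fin.valEmbedding_apply, mem_Ico]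
    exact ⟨fun ⟨b, hb, e⟩ => e ▸ hb, fun hc => ⟨⟨c, by omega⟩, hc, rfl⟩⟩
  rw [← card_map, e, Nat.card_Ico, Nat.add_sub_cancel_left]

theorem card_filter_mem_rowBlock_le (hσ : ∀ i, σ i ∈ rowBlock d a i) (l : Fin n) :
    #{j | l ∈ rowBlock d a j} ≤ 2 * d := by
  have h : #{j | l ∈ rowBlock d a j} ≤ #(Ico ((l : ℕ) + 1 - d) (l + d)) := by
    refine card_le_card_of_injOn (fun j => (σ j : ℕ)) ?_ ?_
    · intro j hj
      have h1 := mem_rowBlock.1 (mem_filter.1 hj).2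
      have h2 := mem_rowBlock.1 (hσ j)
      simp only [coe_Ico, Set.mem_Ico]
      omega
    · intro j _ j' _ h
      exact σ.injective (Fin.ext h)
  rw [Nat.card_Ico] at h
  omega

/-- A family of intervals of length `d` with prescribed weighted counts to the right of `k`
contains `d` equal intervals. -/
theorem exists_card_eq_start {ι : Type*} [DecidableEq ι] (s : Finset ι) (a : ι → ℕ) (k : ℕ)
    (hd : 2 ≤ d)
    (h : ∀ l, k < l → l ≤ k + d →
      #{j ∈ s | (a j ≤ l ∧ l < a j + d) ∧ (a j ≤ k ∧ k < a j + d)} +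
        (d - 1) * #{j ∈ s | a j ≤ l ∧ l < a j + d} = d * (d - 1)) :
    ∃ v, d ≤ #{j ∈ s | a j = v} := by
  set P : ℕ → ℕ := fun l => #{j ∈ s | (a j ≤ l ∧ l < a j + d) ∧ (a j ≤ k ∧ k < a j + d)} with hP
  set R : ℕ → ℕ := fun l => #{j ∈ s | a j ≤ l ∧ l < a j + d} with hR
  have hPR : ∀ l, P l ≤ R l := fun l => card_le_card fun j hj => by
    rw [mem_filter] at hj ⊢; exact ⟨hj.1, hj.2.1⟩
  have hcases : ∀ l, k < l → l ≤ k + d → (P l = 0 ∧ R l = d) ∨ (P l = R l) := by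
    intro l h1 h2
    have e : P l + (d - 1) * R l = d * (d - 1) := h l h1 h2
    have hle := hPR l
    obtain ⟨e', rfl⟩ : ∃ e', d = e' + 2 := ⟨d - 2, by omega⟩
    simp only [show e' + 2 - 1 = e' + 1 by omega] at e
    have hRd : R l ≤ e' + 2 := by
      by_contra hc
      have : (e' + 1) * (e' + 3) ≤ (e' + 1) * R l := Nat.mul_le_mul_left _ (by omega)
      nlinarith
    have hRd' : e' + 1 ≤ R l := by
      by_contra hc
      have : (e' + 1) * R l ≤ (e' + 1) * e' := Nat.mul_le_mul_left _ (by omega)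
      nlinarith
    have : R l = e' + 1 ∨ R l = e' + 2 := by omega
    rcases this with hr | hr
    · right; rw [hr] at e ⊢; nlinarith
    · left; rw [hr] at e; exact ⟨by nlinarith, hr⟩
  have hex : ∃ m, P (k + 1 + m) = 0 := ⟨d - 1, by
    rw [hP]
    refine card_eq_zero.2 (filter_eq_empty_iff.2 fun j _ => ?_)
    omega⟩
  set m := Nat.find hex with hm
  have hm0 : P (k + 1 + m) = 0 := Nat.find_spec hex
  have hmd : m ≤ d - 1 := Nat.find_min' hex (by
    rw [hP]
    refine card_eq_zero.2 (filter_eq_empty_iff.2 fun j _ => ?_)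
    omega)
  have hRm : R (k + 1 + m) = d := by
    have e : P (k + 1 + m) + (d - 1) * R (k + 1 + m) = d * (d - 1) := h _ (by omega) (by omega)
    rw [hm0, zero_add, mul_comm] at e
    exact Nat.eq_of_mul_eq_mul_right (by omega) e
  refine ⟨k + 1 + m, hRm.ge.trans (card_le_card fun j hj => ?_)⟩
  rw [mem_filter] at hj ⊢
  refine ⟨hj.1, ?_⟩
  have hjk : ¬ (a j ≤ k ∧ k < a j + d) := fun hc =>
    filter_eq_empty_iff.1 (card_eq_zero.1 hm0) hj.1 ⟨hj.2, hc⟩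
  by_contra hne
  have hlt : a j ≤ k + m := by omega
  rcases Nat.eq_zero_or_pos m with h0 | h0
  · rw [h0] at hj hlt; omega
  · have hprev : P (k + 1 + (m - 1)) ≠ 0 := Nat.find_min hex (by omega)
    have heq : P (k + 1 + (m - 1)) = R (k + 1 + (m - 1)) := by
      rcases hcases (k + 1 + (m - 1)) (by omega) (by omega) with hc | hc
      · exact absurd hc.1 hprev
      · exact hc
    have hsub := eq_of_subset_of_card_le (s := {j ∈ s | (a j ≤ k + 1 + (m - 1) ∧
      k + 1 + (m - 1) < a j + d) ∧ (a j ≤ k ∧ k < a j + d)})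
      (t := {j ∈ s | a j ≤ k + 1 + (m - 1) ∧ k + 1 + (m - 1) < a j + d})
      (fun j hj => by rw [mem_filter] at hj ⊢; exact ⟨hj.1, hj.2.1⟩) heq.ge
    have : j ∈ ({j ∈ s | a j ≤ k + 1 + (m - 1) ∧ k + 1 + (m - 1) < a j + d} : Finset ι) := by
      rw [mem_filter]; exact ⟨hj.1, by omega⟩
    rw [← hsub, mem_filter] at this
    exact hjk this.2.2

/-- Once `k` is the only column used within distance `2 * d` of itself, some column to the right
of `k` has a definite defect, unless `d` rows coincide. -/
theorem exists_columnDefect_sq_ge (hd : 2 ≤ d) (ha : ∀ i, a i + d ≤ n)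
    (hσ : ∀ i, σ i ∈ rowBlock d a i) (hno : ∀ v, #{j | a j = v} < d)
    (T : Finset (Fin n)) (k : Fin n) (hkn : (k : ℕ) + d < n)
    (hC : T.image σ ∩ columnWindow d k = {k}) :
    ∃ l : Fin n, (k : ℕ) < l ∧ (l : ℕ) ≤ k + d ∧ l ∉ T.image σ ∧
      (1 / ((d : ℝ) * (d - 1))) ^ 2 ≤ columnDefect (rowBlock d a) T (T.image σ) l ^ 2 := by
  have hCk : ∀ c ∈ T.image σ, (k : ℕ) ≤ c + 2 * d → (c : ℕ) ≤ k + 2 * d → c = k := by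
    intro c hc h1 h2
    have : c ∈ T.image σ ∩ columnWindow d k := mem_inter.2 ⟨hc, mem_columnWindow.2 ⟨h1, h2⟩⟩
    rw [hC] at this; simpa using this
  have hkC : k ∈ T.image σ := by
    have : k ∈ ({k} : Finset (Fin n)) := mem_singleton_self k
    rw [← hC] at this; exact (mem_inter.1 this).1
  obtain ⟨i, hiT, hik⟩ := mem_image.1 hkC
  have hd1 : (0 : ℝ) < d - 1 := by
    have : (2 : ℝ) ≤ d := by exact_mod_cast hd
    linarith
  have hd0 : (0 : ℝ) < d := by linarith
  by_contra! hcon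
  have hcount := exists_card_eq_start (univ.erase i) a k hd ?_
  · obtain ⟨v, hv⟩ := hcount
    exact absurd (hno v) (not_lt.2 (hv.trans (card_le_card (filter_subset_filter _ (subset_univ _)))))
  intro l hl1 hl2
  set l' : Fin n := ⟨l, by omega⟩ with hl'
  have hlC : l' ∉ T.image σ := fun h => by
    have h1 := congrArg Fin.val (hCk l' h (by simp [hl']; omega) (by simp [hl']; omega))
    simp only [hl'] at h1
    omega
  have hlt := hcon l' hl1 hl2 hlC
  have hset : ({j ∈ Tᶜ | l' ∈ rowBlock d a j} : Finset (Fin n)) =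
      {j ∈ univ.erase i | a j ≤ l ∧ l < a j + d} := by
    ext j
    simp only [mem_filter, mem_compl, mem_erase, mem_univ, and_true, mem_rowBlock, hl']
    refine and_congr_left fun hj => ⟨fun h e => h (e ▸ hiT), fun h hjT => h ?_⟩
    have h1 := mem_rowBlock.1 (hσ j)
    exact σ.injective ((hCk (σ j) (mem_image_of_mem _ hjT) (by omega) (by omega)).trans hik.symm)
  set s : Finset (Fin n) := {j ∈ univ.erase i | a j ≤ l ∧ l < a j + d} with hs
  have hcard : ∀ j ∈ s, (1 / #(rowBlock d a j \ T.image σ) : ℝ) =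
      if a j ≤ k ∧ k < a j + d then 1 / ((d : ℝ) - 1) else 1 / d := by
    intro j hj
    have hj' := (mem_filter.1 hj).2
    have hinter : ∀ c ∈ rowBlock d a j, c ∈ T.image σ → c = k := fun c hc hcC => by
      have := mem_rowBlock.1 hc
      exact hCk c hcC (by omega) (by omega)
    split_ifs with hk
    · have e : rowBlock d a j \ T.image σ = (rowBlock d a j).erase k := by
        ext c
        simp only [mem_sdiff, mem_erase]
        exact ⟨fun h => ⟨fun e => h.2 (e ▸ hkC), h.1⟩, fun h => ⟨h.2, fun hc => h.1 (hinter c h.2 hc)⟩⟩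
      rw [e, card_erase_of_mem (mem_rowBlock.2 hk), card_rowBlock (ha j), Nat.cast_sub (by omega)]
      simp
    · have e : rowBlock d a j \ T.image σ = rowBlock d a j := by
        rw [Finset.sdiff_eq_self_iff_disjoint, disjoint_left]
        intro c hc hcC
        exact hk (mem_rowBlock.1 (hinter c hc hcC ▸ hc))
      rw [e, card_rowBlock (ha j)]
  set P := #{j ∈ s | a j ≤ k ∧ k < a j + d} with hP
  have hPs : P + #{j ∈ s | ¬ (a j ≤ k ∧ k < a j + d)} = #s := card_filter_add_card_filter_not _
  have hD : columnDefect (rowBlock d a) T (T.image σ) l' =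
      ((d * (d - 1) - P - (d - 1) * #s : ℤ) : ℝ) * (1 / ((d : ℝ) * (d - 1))) := by
    rw [columnDefect, hset, sum_congr rfl hcard, sum_ite]
    simp only [sum_const, nsmul_eq_mul]
    rw [← hP, ← hPs]
    push_cast
    field_simp
    ring
  rw [hD, mul_pow] at hlt
  have hpos : 0 < (1 / ((d : ℝ) * (d - 1))) ^ 2 := by positivity
  have hint : ((d * (d - 1) - P - (d - 1) * #s : ℤ) : ℝ) ^ 2 < 1 := by
    by_contra hc
    nlinarith
  have hz : (d * (d - 1) - P - (d - 1) * #s : ℤ) = 0 := by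
    have : (d * (d - 1) - P - (d - 1) * #s : ℤ) ^ 2 < 1 := by exact_mod_cast hint
    have h1 := sq_nonneg (d * (d - 1) - P - (d - 1) * #s : ℤ)
    exact pow_eq_zero_iff (two_ne_zero) |>.1 (by omega)
  rw [← filter_filter, ← hs, ← hP]
  zify [show 1 ≤ d by omega]
  linarith

end

/-- The share of the column window of `k` in the potential: it is positive as long as no column of
the window is used, or only `k` itself. -/
noncomputable def windowGain {n : ℕ} (d : ℕ) (θ : ℝ) (k : Fin n) (C : Finset (Fin n)) : ℝ :=
  if C ∩ columnWindow d k = ∅ then θ / (4 * d + 1) else if C ∩ columnWindow d k = {k} then θ else 0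

/-- The loss per row, compared with Brègman's bound, for matrices without `d` equal rows. -/
noncomputable def bregmanGap (d : ℕ) : ℝ :=
  1 / (8 * (2 * d + 1)) / 2 * (1 / ((d : ℝ) * (d - 1))) ^ 2 / (4 * d + 1) / (4 * d + 1)

section
open Finset
variable {n d : ℕ} {a : Fin n → ℕ} {σ : Equiv.Perm (Fin n)}

theorem card_compl_mul_windowGain_le {θ : ℝ} (hθ : 0 ≤ θ) (k : Fin n) (C : Finset (Fin n)) :
    #Cᶜ * windowGain d θ k C ≤ ∑ l ∈ Cᶜ, windowGain d θ k (insert l C) +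
      if C ∩ columnWindow d k = {k} then (4 * d + 1) * θ else 0 := by
  set W := columnWindow d k with hW
  have hkW : k ∈ W := mem_columnWindow.2 ⟨by omega, by omega⟩
  have hWc : (#(Cᶜ ∩ W) : ℝ) ≤ 4 * d + 1 := by
    exact_mod_cast (card_le_card inter_subset_right).trans (card_columnWindow_le k)
  have hnn : ∀ C, 0 ≤ windowGain d θ k C := fun C => by
    rw [windowGain]; split_ifs <;> positivity
  have hout : ∀ l ∉ W, windowGain d θ k (insert l C) = windowGain d θ k C := fun l hl => by
    rw [windowGain, windowGain, ← hW, insert_inter_of_notMem hl]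
  have hgen : #Cᶜ * windowGain d θ k C - (4 * d + 1) * windowGain d θ k C ≤
      ∑ l ∈ Cᶜ, (if l ∈ W then 0 else windowGain d θ k C) := by
    have h : ∀ l ∈ Cᶜ, (if l ∈ W then 0 else windowGain d θ k C) =
        windowGain d θ k C - if l ∈ W then windowGain d θ k C else 0 := fun l _ => by
      split_ifs <;> simp
    rw [sum_congr rfl h, sum_sub_distrib, sum_ite_mem]
    simp only [sum_const, nsmul_eq_mul]
    have := mul_le_mul_of_nonneg_right hWc (hnn C)
    linarith
  by_cases h0 : C ∩ W = ∅
  · have hne : ¬ C ∩ W = {k} := by rw [h0]; exact (singleton_ne_empty k).symm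
    have hg : windowGain d θ k C = θ / (4 * d + 1) := by rw [windowGain, ← hW, if_pos h0]
    have hkC : k ∈ Cᶜ := mem_compl.2 fun hk => by
      have : k ∈ C ∩ W := mem_inter.2 ⟨hk, hkW⟩
      rw [h0] at this; exact notMem_empty _ this
    have hgk : windowGain d θ k (insert k C) = θ := by
      rw [windowGain, ← hW, insert_inter_of_mem hkW, h0, if_neg (insert_ne_empty _ _),
        insert_empty_eq, if_pos rfl]
    have h : ∀ l ∈ Cᶜ, (if l ∈ W then 0 else windowGain d θ k C) + (if l = k then θ else 0) ≤
        windowGain d θ k (insert l C) := by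
      intro l _
      by_cases hl : l = k
      · subst hl; rw [hgk, if_pos hkW, if_pos rfl, zero_add]
      · rw [if_neg hl, add_zero]
        split_ifs with hlW
        · exact hnn _
        · exact (hout l hlW).ge
    have h1 := sum_le_sum h
    rw [sum_add_distrib, sum_ite_eq' Cᶜ k, if_pos hkC] at h1
    have h2 : (4 * d + 1) * windowGain d θ k C = θ := by
      rw [hg]; field_simp
    rw [if_neg hne]
    linarith
  · by_cases h1 : C ∩ W = {k}
    · have hg : windowGain d θ k C = θ := by rw [windowGain, ← hW, if_neg h0, if_pos h1]
      have h : ∀ l ∈ Cᶜ, (if l ∈ W then 0 else windowGain d θ k C) ≤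
          windowGain d θ k (insert l C) := by
        intro l _
        split_ifs with hlW
        · exact hnn _
        · exact (hout l hlW).ge
      have h2 := sum_le_sum h
      rw [if_pos h1]
      rw [hg] at hgen h2 ⊢
      linarith
    · rw [windowGain, ← hW, if_neg h0, if_neg h1, if_neg h1, mul_zero, add_zero]
      exact sum_nonneg fun l _ => hnn _

theorem card_isolated_mul_le (hd : 2 ≤ d) (ha : ∀ i, a i + d ≤ n)
    (hσ : ∀ i, σ i ∈ rowBlock d a i) (hno : ∀ v, #{j | a j = v} < d) (T : Finset (Fin n)) :
    (#{k : Fin n | (k : ℕ) + d < n ∧ T.image σ ∩ columnWindow d k = {k}} : ℝ) *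
        (1 / ((d : ℝ) * (d - 1))) ^ 2 ≤
      ∑ l ∈ (T.image σ)ᶜ, columnDefect (rowBlock d a) T (T.image σ) l ^ 2 := by
  set B : Finset (Fin n) := {k : Fin n | (k : ℕ) + d < n ∧ T.image σ ∩ columnWindow d k = {k}}
    with hB
  have hex : ∀ k : Fin n, k ∈ B → ∃ l : Fin n, (k : ℕ) < l ∧ (l : ℕ) ≤ k + d ∧ l ∉ T.image σ ∧
      (1 / ((d : ℝ) * (d - 1))) ^ 2 ≤ columnDefect (rowBlock d a) T (T.image σ) l ^ 2 :=
    fun k hk => by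
      have := (mem_filter.1 hk).2
      exact exists_columnDefect_sq_ge hd ha hσ hno T k this.1 this.2
  choose! f hf1 hf2 hf3 hf4 using hex
  have hinj : Set.InjOn f B := by
    intro k hk k' hk' h
    have hkC : k ∈ T.image σ := by
      have : k ∈ ({k} : Finset (Fin n)) := mem_singleton_self k
      rw [← (mem_filter.1 hk).2.2] at this; exact (mem_inter.1 this).1
    have h1 := hf1 k hk
    have h2 := hf2 k hk
    have h3 := hf1 k' hk'
    have h4 := hf2 k' hk'
    rw [h] at h1 h2
    have : k ∈ T.image σ ∩ columnWindow d k' :=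
      mem_inter.2 ⟨hkC, mem_columnWindow.2 ⟨by omega, by omega⟩⟩
    rw [(mem_filter.1 hk').2.2] at this
    exact mem_singleton.1 this
  calc _ = ∑ k ∈ B, (1 / ((d : ℝ) * (d - 1))) ^ 2 := by rw [sum_const, nsmul_eq_mul]
    _ ≤ ∑ k ∈ B, columnDefect (rowBlock d a) T (T.image σ) (f k) ^ 2 := sum_le_sum hf4
    _ = ∑ l ∈ B.image f, columnDefect (rowBlock d a) T (T.image σ) l ^ 2 := by
        rw [sum_image hinj]
    _ ≤ _ := sum_le_sum_of_subset_of_nonneg (fun l hl => by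
        obtain ⟨k, hk, rfl⟩ := mem_image.1 hl
        exact mem_compl.2 (hf3 k hk)) fun _ _ _ => sq_nonneg _

theorem bregmanGap_pos (hd : 2 ≤ d) : 0 < bregmanGap d := by
  have hd1 : (0 : ℝ) < d - 1 := by
    have : (2 : ℝ) ≤ d := by exact_mod_cast hd
    linarith
  have hd0 : (0 : ℝ) < d := by linarith
  rw [bregmanGap]
  positivity

/-- A strict form of Brègman's inequality for interval matrices without `d` equal rows. -/
theorem log_card_le_sub_bregmanGap (hd : 2 ≤ d) (hdn : d ≤ n) (ha : ∀ i, a i + d ≤ n)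
    (hno : ∀ v, #{j | a j = v} < d)
    (hne : ({σ : Equiv.Perm (Fin n) | ∀ i, σ i ∈ rowBlock d a i} : Finset _).Nonempty) :
    Real.log #{σ : Equiv.Perm (Fin n) | ∀ i, σ i ∈ rowBlock d a i} ≤
      n * bregmanLog d - (n - d) * bregmanGap d := by
  have hd1 : (0 : ℝ) < d - 1 := by
    have : (2 : ℝ) ≤ d := by exact_mod_cast hd
    linarith
  have hd0 : (0 : ℝ) < d := by linarith
  set S : Finset (Equiv.Perm (Fin n)) := {σ | ∀ i, σ i ∈ rowBlock d a i} with hS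
  have hSσ : ∀ σ ∈ S, ∀ i, σ i ∈ rowBlock d a i := fun σ h => (mem_filter.1 h).2
  set ε : ℝ := 1 / (8 * (2 * d + 1)) with hε
  set δ : ℝ := (1 / ((d : ℝ) * (d - 1))) ^ 2 with hδ
  set θ : ℝ := ε / 2 * δ / (4 * d + 1) with hθ
  have hε0 : 0 < ε := by positivity
  have hθ0 : 0 ≤ θ := by positivity
  have hK0 : (0 : ℝ) ≤ 2 * d := by positivity
  have hK : ∀ σ ∈ S, ∀ l, (#{j | l ∈ rowBlock d a j} : ℝ) ≤ 2 * d := fun σ h l => by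
    exact_mod_cast card_filter_mem_rowBlock_le (hSσ σ h) l
  set B : Finset (Fin n) := {k | (k : ℕ) + d < n} with hB
  set F : Finset (Fin n) → Finset (Fin n) → ℝ := fun T C =>
    ∑ j ∈ Tᶜ, bregmanLog #(rowBlock d a j \ C) -
      ∑ k ∈ B, windowGain d θ k C with hF
  have hmain := log_card_le_of_step S F (tiltedKernel (rowBlock d a) ε) ?_ ?_ ?_ ?_ ?_ hne
  · refine hmain.trans (le_of_eq ?_)
    have hk : ∀ k : Fin n, windowGain d θ k ∅ = bregmanGap d := fun k => by
      rw [windowGain, if_pos (empty_inter _)]; rfl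
    have hcard : ∀ j, #(rowBlock d a j) = d := fun j => card_rowBlock (ha j)
    have hcount : (#B : ℝ) = n - d := by
      rw [← Nat.cast_sub hdn]
      have : B.map Fin.valEmbedding =
          range (n - d) := by
        ext c
        simp only [hB, mem_map, mem_filter, mem_univ, true_and, Fin.valEmbedding_apply, mem_range]
        exact ⟨fun ⟨b, hb, e⟩ => by omega, fun hc => ⟨⟨c, by omega⟩, by simp; omega, rfl⟩⟩
      rw [← card_map, this, card_range]
    simp only [hF, sdiff_empty, hcard, hk, compl_empty, sum_const, nsmul_eq_mul, card_univ,
      Fintype.card_fin, hcount]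
  · simp only [hF, compl_univ, sum_empty, zero_sub, Left.nonneg_neg_iff]
    refine sum_nonpos fun k hk => ?_
    have hk' := (mem_filter.1 hk).2
    have h1 : k ∈ columnWindow d k := mem_columnWindow.2 ⟨by omega, by omega⟩
    have h2 : (⟨k + 1, by omega⟩ : Fin n) ∈ columnWindow d k :=
      mem_columnWindow.2 ⟨by simp; omega, by simp; omega⟩
    rw [windowGain, univ_inter, if_neg (ne_empty_of_mem h1), if_neg]
    intro h
    rw [h, mem_singleton, Fin.ext_iff] at h2
    simp at h2
  · rintro T C ⟨σ, hσ, rfl⟩ i k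
    exact (tiltedKernel_nonneg hK0 hε (hSσ σ hσ) (hK σ hσ) T i k).2
  · intro T σ hσ i hi
    have hmem := apply_mem_sdiff_image (hSσ σ hσ) hi
    have := (tiltedKernel_nonneg hK0 hε (hSσ σ hσ) (hK σ hσ) T i (σ i)).1
    have hr : (0 : ℝ) < #(rowBlock d a i \ T.image σ) := by exact_mod_cast card_pos.2 ⟨_, hmem⟩
    rw [tiltedKernel, if_pos hmem]
    positivity
  · rintro T C ⟨σ, hσ, rfl⟩ i hi
    exact (sum_tiltedKernel (hSσ σ hσ) hi).le
  · intro T σ hσ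
    have hσ' := hSσ σ hσ
    set C := T.image σ with hC
    have hlog : ∀ i ∈ Tᶜ, F (insert i T) (insert (σ i) C) -
        Real.log (tiltedKernel (rowBlock d a) ε T C i (σ i)) =
        (∑ j ∈ (insert i T)ᶜ, bregmanLog #(rowBlock d a j \ insert (σ i) C) +
          Real.log #(rowBlock d a i \ C)) -
        Real.log (1 + defectTilt (rowBlock d a) ε T C i (σ i)) -
        ∑ k ∈ B, windowGain d θ k (insert (σ i) C) := by
      intro i hi
      have hmem := apply_mem_sdiff_image hσ' (mem_compl.1 hi)
      have hr : (0 : ℝ) < #(rowBlock d a i \ C) := by exact_mod_cast card_pos.2 ⟨_, hmem⟩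
      have ht := (tiltedKernel_nonneg hK0 hε hσ' (hK σ hσ) T i (σ i)).1
      rw [tiltedKernel, if_pos hmem, Real.log_div ht.ne' hr.ne']
      simp only [hF]
      ring
    rw [sum_congr rfl hlog, sum_sub_distrib, sum_sub_distrib, sum_bregmanLog_insert hσ', ← hC,
      sum_compl_apply T (fun l => ∑ k ∈ B, windowGain d θ k (insert l C)),
      sum_comm, ← hC]
    have h1 := sum_log_defectTilt_ge hK0 hε hσ' (hK σ hσ) T
    have h2 := card_isolated_mul_le hd ha hσ' hno T
    have h3 := sum_le_sum fun k (_ : k ∈ B) =>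
      card_compl_mul_windowGain_le (d := d) hθ0 k C
    rw [sum_add_distrib, ← mul_sum, ← sum_filter, filter_filter, sum_const, nsmul_eq_mul] at h3
    have h4 : (4 * d + 1) * θ = ε / 2 * δ := by rw [hθ]; field_simp
    have h5 : #Cᶜ = #Tᶜ := by
      rw [card_compl, card_compl, hC, card_image_of_injective _ σ.injective]
    rw [h4, h5] at h3
    have h6 := mul_le_mul_of_nonneg_left h2 (show 0 ≤ ε / 2 by positivity)
    simp only [hF, mul_sub]
    linarith

end

/-- The number of permutations supported on the interval rows with starting columns `a`. -/
def matchCount {n : ℕ} (d : ℕ) (a : Fin n → ℕ) : ℕ :=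
  Finset.card {σ : Equiv.Perm (Fin n) | ∀ i, σ i ∈ rowBlock d a i}

/-- Starting columns of the direct sum with an all-ones block. -/
def appendBlock {n : ℕ} (d : ℕ) (a : Fin n → ℕ) : Fin (n + d) → ℕ :=
  fun i => if h : (i : ℕ) < n then a ⟨i, h⟩ else n

section
open Finset

theorem permanent_confMatrix_s16 {n d : ℕ} (hd : 0 < d) (a : Fin n → ℕ) :
    permanent (confMatrix n d fun i => a i + 1) = matchCount d a := by
  rw [permanent, matchCount, card_filter]
  refine sum_congr rfl fun σ _ => ?_
  have h : ∀ i c, confMatrix n d (fun i => a i + 1) i c = if c ∈ rowBlock d a i then 1 else 0 := by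
    intro i c
    rw [confMatrix]
    refine if_congr ?_ rfl rfl
    rw [mem_rowBlock]; omega
  simp only [h, prod_boole, mem_univ, true_implies]

theorem isGamma_iff {n d : ℕ} (hdn : d ≤ n) (A : Matrix (Fin n) (Fin n) ℕ) :
    IsGamma n d A ↔
      ∃ a : Fin n → ℕ, (∀ i, a i + d ≤ n) ∧ A = confMatrix n d fun i => a i + 1 := by
  constructor
  · rintro ⟨x, hx, rfl⟩
    refine ⟨fun i => x i - 1, fun i => ?_, ?_⟩
    · have := hx i; dsimp only; omega
    · congr 1; funext i; have := (hx i).1; dsimp only; omega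
  · rintro ⟨a, ha, rfl⟩
    exact ⟨_, fun i => by have := ha i; omega, rfl⟩

theorem addOnesBlock_confMatrix {n d : ℕ} (a : Fin n → ℕ) (ha : ∀ i, a i + d ≤ n) :
    addOnesBlock n d (confMatrix n d fun i => a i + 1) =
      confMatrix (n + d) d fun i => appendBlock d a i + 1 := by
  ext i j
  rw [addOnesBlock, confMatrix, appendBlock]
  have hj := j.isLt
  by_cases hi : (i : ℕ) < n
  · have := ha ⟨i, hi⟩
    rw [dif_pos hi, dif_pos hi]
    by_cases hjn : (j : ℕ) < n
    · rw [dif_pos hjn, confMatrix]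
    · rw [dif_neg hjn, if_neg (by omega)]
  · rw [dif_neg hi, dif_neg hi]
    by_cases hjn : (j : ℕ) < n
    · rw [if_pos hjn, if_neg (by omega)]
    · rw [if_neg hjn, if_pos (by omega)]

theorem appendBlock_add_le {n d : ℕ} {a : Fin n → ℕ} (ha : ∀ i, a i + d ≤ n) (i : Fin (n + d)) :
    appendBlock d a i + d ≤ n + d := by
  rw [appendBlock]
  split_ifs with h
  · have := ha ⟨i, h⟩; omega
  · exact le_rfl

theorem factorial_mul_matchCount_le {n d : ℕ} (a : Fin n → ℕ) :
    d.factorial * matchCount d a ≤ matchCount d (appendBlock d a) := by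
  have hcard : d.factorial * matchCount d a =
      #(({σ : Equiv.Perm (Fin n) | ∀ i, σ i ∈ rowBlock d a i} : Finset _) ×ˢ
        (univ : Finset (Equiv.Perm (Fin d)))) := by
    rw [card_product, card_univ, Fintype.card_perm, Fintype.card_fin, mul_comm]; rfl
  rw [hcard, matchCount]
  refine card_le_card_of_injOn
    (fun p => finSumFinEquiv.permCongr (Equiv.sumCongr p.1 p.2)) ?_ ?_
  · rintro ⟨σ, τ⟩ h
    have hσ := (mem_filter.1 (mem_product.1 h).1).2
    simp only [coe_filter, Set.mem_ofPred_eq, mem_univ, true_and]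
    intro i
    obtain ⟨s, rfl⟩ := finSumFinEquiv.surjective i
    rcases s with i | i
    · have := mem_rowBlock.1 (hσ i)
      simpa [mem_rowBlock, appendBlock, Equiv.permCongr_apply] using this
    · simp [mem_rowBlock, appendBlock, Equiv.permCongr_apply]
  · rintro ⟨σ, τ⟩ _ ⟨σ', τ'⟩ _ h
    have h' : Equiv.sumCongr σ τ = Equiv.sumCongr σ' τ' :=
      finSumFinEquiv.permCongr.injective h
    refine Prod.ext (Equiv.ext fun i => ?_) (Equiv.ext fun i => ?_)
    · simpa using Equiv.congr_fun h' (Sum.inl i)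
    · simpa using Equiv.congr_fun h' (Sum.inr i)

/-- Deleting `d` equal rows together with their columns loses at most a factor `d!`. -/
theorem matchCount_le_factorial_mul {n d v : ℕ} {b : Fin (n + d) → ℕ} {a : Fin n → ℕ}
    (hd : 0 < d) (hv : v ≤ n) (R : Finset (Fin (n + d))) (hR : #R = d) (hb : ∀ i ∈ R, b i = v)
    (e : {i // i ∉ R} ≃ Fin n)
    (h : ∀ (i : {i // i ∉ R}) (c : Fin (n + d)) (c' : Fin n), c ∈ rowBlock d b i →
      ((c : ℕ) < v ∧ (c' : ℕ) = c ∨ v + d ≤ c ∧ (c' : ℕ) + d = c) → c' ∈ rowBlock d a (e i)) :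
    matchCount d b ≤ d.factorial * matchCount d a := by
  let J : Finset (Fin (n + d)) := {c | v ≤ c ∧ (c : ℕ) < v + d}
  have hJ : ∀ c, c ∈ J ↔ v ≤ c ∧ (c : ℕ) < v + d := fun c => by simp [J]
  have hJcard : #J = d := card_rowBlock (a := fun _ : Fin (n + d) => v) (i := ⟨v, by omega⟩) (by omega)
  let f : {c // c ∉ J} ≃ Fin n :=
    { toFun := fun c => ⟨if (c.1 : ℕ) < v then c.1 else c.1 - d, by
        have h1 := c.2
        have h2 := c.1.isLt
        rw [hJ] at h1
        split_ifs <;> omega⟩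
      invFun := fun c => ⟨⟨if (c : ℕ) < v then c else c + d, by
        have := c.isLt
        split_ifs <;> omega⟩, by
          rw [hJ]; dsimp only; split_ifs <;> omega⟩
      left_inv := fun c => by
        have h1 := c.2
        rw [hJ] at h1
        ext
        dsimp only
        split_ifs <;> omega
      right_inv := fun c => by
        ext
        dsimp only
        split_ifs <;> omega }
  have hf : ∀ c, ((c.1 : ℕ) < v ∧ (f c : ℕ) = c.1 ∨ v + d ≤ c.1 ∧ (f c : ℕ) + d = c.1) := by
    intro c
    have h1 := c.2
    rw [hJ] at h1
    simp only [f, Equiv.coe_fn_mk]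
    split_ifs <;> omega
  set S : Finset (Equiv.Perm (Fin (n + d))) := {σ | ∀ i, σ i ∈ rowBlock d b i} with hS
  have hRJ : ∀ σ ∈ S, ∀ i, i ∈ R ↔ σ i ∈ J := by
    intro σ hσ i
    have himg : R.image σ = J := by
      refine eq_of_subset_of_card_le (fun c hc => ?_) ?_
      · obtain ⟨j, hj, rfl⟩ := mem_image.1 hc
        have := mem_rowBlock.1 ((mem_filter.1 hσ).2 j)
        rw [hb j hj] at this
        exact (hJ _).2 this
      · rw [card_image_of_injective _ σ.injective, hR, hJcard]
    rw [← himg, mem_image]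
    exact ⟨fun hi => ⟨i, hi, rfl⟩, fun ⟨j, hj, e⟩ => σ.injective e ▸ hj⟩
  let g : S → ({i // i ∈ R} ≃ {c // c ∈ J}) ×
      {σ : Equiv.Perm (Fin n) // σ ∈ ({σ | ∀ i, σ i ∈ rowBlock d a i} : Finset _)} := fun σ =>
    ⟨σ.1.subtypeEquiv (hRJ σ.1 σ.2),
      ⟨(e.symm.trans (σ.1.subtypeEquiv fun i => not_congr (hRJ σ.1 σ.2 i))).trans f, by
        simp only [mem_filter, mem_univ, true_and]
        intro i
        have h1 := (mem_filter.1 σ.2).2 (e.symm i)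
        have h2 := h (e.symm i) _ (f ⟨σ.1 (e.symm i), (not_congr (hRJ σ.1 σ.2 _)).1 (e.symm i).2⟩)
          h1 (hf ⟨σ.1 (e.symm i), (not_congr (hRJ σ.1 σ.2 _)).1 (e.symm i).2⟩)
        rw [e.apply_symm_apply] at h2
        exact h2⟩⟩
  have hg : Function.Injective g := by
    intro σ τ hστ
    refine Subtype.ext (Equiv.ext fun i => ?_)
    by_cases hi : i ∈ R
    · have h1 := congrArg (fun p => ((p.1 ⟨i, hi⟩ : {c // c ∈ J}) : Fin (n + d))) hστ
      exact h1
    · have h1 := congrArg (fun p => (f.symm (p.2.1 (e ⟨i, hi⟩)) : Fin (n + d))) hστ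
      simpa [g] using h1
  have hle := Fintype.card_le_of_injective g hg
  rw [Fintype.card_prod, Fintype.card_coe, Fintype.card_coe,
    Fintype.card_equiv (Fintype.equivOfCardEq (by simp [hR, hJcard])), Fintype.card_coe, hR] at hle
  exact hle

theorem matchCount_appendBlock_le {n d : ℕ} (hd : 0 < d) (a : Fin n → ℕ) (ha : ∀ i, a i + d ≤ n) :
    matchCount d (appendBlock d a) ≤ d.factorial * matchCount d a := by
  have hmem : ∀ i : Fin (n + d), i ∉ ({i : Fin (n + d) | n ≤ (i : ℕ)} : Finset _) ↔ (i : ℕ) < n :=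
    fun i => by simp
  refine matchCount_le_factorial_mul (v := n) hd le_rfl {i : Fin (n + d) | n ≤ (i : ℕ)} ?_ ?_
    { toFun := fun i => ⟨i.1, (hmem i.1).1 i.2⟩
      invFun := fun i => ⟨i.castLE (by omega), (hmem _).2 i.isLt⟩
      left_inv := fun _ => rfl
      right_inv := fun _ => rfl } ?_
  · have e : ({i : Fin (n + d) | n ≤ (i : ℕ)} : Finset _).map Fin.valEmbedding = Ico n (n + d) := by
      ext c
      simp only [mem_map, mem_filter, mem_univ, true_and, Fin.valEmbedding_apply, mem_Ico]
      exact ⟨fun ⟨b, hb, e⟩ => by omega, fun hc => ⟨⟨c, hc.2⟩, hc.1, rfl⟩⟩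
    rw [← card_map, e, Nat.card_Ico, Nat.add_sub_cancel_left]
  · intro i hi
    have := (mem_filter.1 hi).2
    rw [appendBlock, dif_neg (by omega)]
  · rintro ⟨i, hi⟩ c c' hc hcc
    have hi' := (hmem i).1 hi
    rw [mem_rowBlock, appendBlock, dif_pos hi'] at hc
    replace hc : a ⟨i, hi'⟩ ≤ c ∧ (c : ℕ) < a ⟨i, hi'⟩ + d := hc
    have := ha ⟨i, hi'⟩
    rw [mem_rowBlock]
    change a ⟨i, hi'⟩ ≤ c' ∧ (c' : ℕ) < a ⟨i, hi'⟩ + d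
    omega

theorem exists_matchCount_le_of_equal_rows {n d v : ℕ} {b : Fin (n + d) → ℕ} (hd : 0 < d)
    (hdn : d ≤ n) (hb : ∀ i, b i + d ≤ n + d) (hv : d ≤ #{j | b j = v}) :
    ∃ a : Fin n → ℕ, (∀ i, a i + d ≤ n) ∧ matchCount d b ≤ d.factorial * matchCount d a := by
  obtain ⟨R, hRs, hR⟩ := exists_subset_card_eq hv
  have hRv : ∀ i ∈ R, b i = v := fun i hi => (mem_filter.1 (hRs hi)).2
  obtain ⟨i₀, hi₀⟩ : R.Nonempty := card_pos.1 (by omega)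
  have hvn : v ≤ n := by have := hb i₀; rw [hRv i₀ hi₀] at this; omega
  have e : {i // i ∉ R} ≃ Fin n := Fintype.equivFinOfCardEq (by
    rw [Fintype.card_subtype_compl]; simp [hR])
  refine ⟨fun i => min (n - d) (if b (e.symm i) < v then b (e.symm i)
    else max v (b (e.symm i) - d)), fun i => by dsimp only; omega,
    matchCount_le_factorial_mul hd hvn R hR hRv e fun i c c' hc hcc => ?_⟩
  have h1 := hb i
  have h2 := c'.isLt
  rw [mem_rowBlock] at hc ⊢
  simp only [Equiv.symm_apply_apply]
  split_ifs <;> omega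

theorem bregmanLog_nonneg (m : ℕ) : 0 ≤ bregmanLog m := by
  rw [bregmanLog]
  exact div_nonneg (Real.log_nonneg (Nat.one_le_cast.2 (Nat.factorial_pos m))) (by positivity)

theorem exists_log_matchCount_ge {d : ℕ} (hd : 0 < d) (n : ℕ) (hdn : d ≤ n) :
    ∃ a : Fin n → ℕ, (∀ i, a i + d ≤ n) ∧ 0 < matchCount d a ∧
      (n - 2 * d) * bregmanLog d ≤ Real.log (matchCount d a) := by
  induction n using Nat.strong_induction_on with
  | _ n ih =>
    by_cases hn : n < 2 * d
    · have hpos : 0 < matchCount d (fun i : Fin n => min (i : ℕ) (n - d)) := by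
        refine card_pos.2 ⟨1, ?_⟩
        simp only [mem_filter, mem_univ, true_and, Equiv.Perm.coe_one, id_eq, mem_rowBlock]
        intro i
        have := i.isLt
        omega
      refine ⟨_, fun i => ?_, hpos, ?_⟩
      · omega
      · refine le_trans ?_ (Real.log_nonneg (by exact_mod_cast hpos))
        have : (n : ℝ) < 2 * d := by exact_mod_cast hn
        exact mul_nonpos_of_nonpos_of_nonneg (by linarith) (bregmanLog_nonneg d)
    · obtain ⟨m, rfl⟩ : ∃ m, n = m + d := ⟨n - d, by omega⟩
      obtain ⟨a, ha, hpos, hlog⟩ := ih m (by omega) (by omega)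
      have hle := factorial_mul_matchCount_le (d := d) a
      have hfac := Nat.factorial_pos d
      refine ⟨appendBlock d a, appendBlock_add_le ha, lt_of_lt_of_le (by positivity) hle, ?_⟩
      have h1 : Real.log (d.factorial * matchCount d a : ℕ) ≤
          Real.log (matchCount d (appendBlock d a)) :=
        Real.log_le_log (by positivity) (by exact_mod_cast hle)
      rw [Nat.cast_mul, Real.log_mul (by positivity) (by positivity), ← mul_bregmanLog] at h1
      push_cast
      linarith

/-- For large `n`, adding `d` rows and columns multiplies the largest permanent by at most `d!`. -/
theorem exists_matchCount_le {d : ℕ} (hd : 0 < d) :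
    ∃ μ : ℕ, d ≤ μ ∧ ∀ n, μ ≤ n → ∀ b : Fin (n + d) → ℕ, (∀ i, b i + d ≤ n + d) →
      ∃ a : Fin n → ℕ, (∀ i, a i + d ≤ n) ∧ matchCount d b ≤ d.factorial * matchCount d a := by
  obtain ⟨m, hm⟩ := exists_nat_ge (2 * d * bregmanLog d / bregmanGap d)
  refine ⟨max d m, le_max_left _ _, fun n hn b hb => ?_⟩
  have hdn : d ≤ n := (le_max_left _ _).trans hn
  have hmn : (m : ℝ) ≤ n := by exact_mod_cast (le_max_right _ _).trans hn
  by_cases hv : ∃ v, d ≤ #{j | b j = v}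
  · obtain ⟨v, hv⟩ := hv
    exact exists_matchCount_le_of_equal_rows hd hdn hb hv
  push Not at hv
  have hd2 : 2 ≤ d := by
    have h := hv (b ⟨0, by omega⟩)
    have : 0 < #{j | b j = b ⟨0, by omega⟩} := card_pos.2 ⟨⟨0, by omega⟩, by simp⟩
    omega
  obtain ⟨a, ha, hpos, hlog⟩ := exists_log_matchCount_ge hd n hdn
  refine ⟨a, ha, ?_⟩
  rcases Nat.eq_zero_or_pos (matchCount d b) with h0 | h0
  · rw [h0]; exact Nat.zero_le _
  have hupper := log_card_le_sub_bregmanGap hd2 (by omega) hb hv (card_pos.1 h0)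
  have hgap := bregmanGap_pos hd2
  have h1 := (div_le_iff₀ hgap).1 (hm.trans hmn)
  have hfac := Nat.factorial_pos d
  have h2 : Real.log (matchCount d b) ≤ Real.log (d.factorial * matchCount d a : ℕ) := by
    rw [Nat.cast_mul, Real.log_mul (by positivity) (by positivity), ← mul_bregmanLog]
    refine hupper.trans ?_
    push_cast
    linarith
  have h3 := (Real.log_le_log_iff (by exact_mod_cast h0) (by positivity)).1 h2
  exact_mod_cast h3

end

/-- **Periodicity of the optimal matrices.**  For each positive integer `d` there exists
`μ_d` such that for all `n ≥ μ_d` and all `A ∈ Γ_n^d`: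
`A ∈ M_n^d` if and only if `A ⊕ 1_{d×d} ∈ M_{n+d}^d`. -/
theorem periodicity (d : ℕ) (hd : 0 < d) :
    ∃ μ : ℕ, ∀ n : ℕ, μ ≤ n → ∀ A : Matrix (Fin n) (Fin n) ℕ, IsGamma n d A →
      (MaxPerm n d A ↔ MaxPerm (n + d) d (addOnesBlock n d A)) := by
  obtain ⟨μ, hμd, hμ⟩ := exists_matchCount_le hd
  refine ⟨μ, fun n hn A hA => ?_⟩
  have hdn : d ≤ n := hμd.trans hn
  obtain ⟨a, ha, rfl⟩ := (isGamma_iff hdn A).1 hA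
  rw [addOnesBlock_confMatrix a ha]
  constructor
  · rintro ⟨-, hmax⟩
    refine ⟨(isGamma_iff (by omega) _).2 ⟨_, appendBlock_add_le ha, rfl⟩, fun B hB => ?_⟩
    obtain ⟨b, hb, rfl⟩ := (isGamma_iff (by omega) B).1 hB
    obtain ⟨a', ha', hle⟩ := hμ n hn b hb
    have h := hmax _ ((isGamma_iff hdn _).2 ⟨a', ha', rfl⟩)
    rw [permanent_confMatrix_s16 hd, permanent_confMatrix_s16 hd] at h ⊢
    exact hle.trans ((Nat.mul_le_mul_left _ h).trans (factorial_mul_matchCount_le a))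
  · rintro ⟨-, hmax⟩
    refine ⟨hA, fun B hB => ?_⟩
    obtain ⟨b, hb, rfl⟩ := (isGamma_iff hdn B).1 hB
    have h := hmax _ ((isGamma_iff (by omega) _).2 ⟨_, appendBlock_add_le hb, rfl⟩)
    rw [permanent_confMatrix_s16 hd, permanent_confMatrix_s16 hd] at h ⊢
    exact Nat.le_of_mul_le_mul_left ((factorial_mul_matchCount_le b).trans
      (h.trans (matchCount_appendBlock_le hd a ha))) (Nat.factorial_pos d)
end
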